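/- arXiv:1309.5754 — 7 statements merged into one kernel-verified Lean document; each statement's English description precedes it below -/
import Mathlib

section
/- Let H be a subgroup of order 3 of the symmetric group S_4, and let λ : S_4 → Sym(S_4⧸H) be the homomorphism given by left translation on left cosets. Then: (a) H has no normal complement in S_4; and (b) there exists a regular subgroup N of Sym(S_4⧸H), isomorphic to the elementary abelian group (ℤ/2ℤ)³, that is normalized by λ(S_4). -/
open Pointwise

/-- `N` is a normal complement of `H` in `G`: `N` is normal, `N ∩ H = 1` and `NH = G`. -/
def IsNormalComplement {G : Type*} [Group G] (N H : Subgroup G) : Prop :=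
  N.Normal ∧ N ⊓ H = ⊥ ∧ (N : Set G) * (H : Set G) = Set.univ

/-- A subgroup of the symmetric group of `X` is regular if it is transitive and
every point stabilizer in it is trivial. -/
def IsRegularSubgroup {X : Type*} (N : Subgroup (Equiv.Perm X)) : Prop :=
  (∀ x y : X, ∃ σ ∈ N, σ x = y) ∧ (∀ σ ∈ N, ∀ x : X, σ x = x → σ = 1)

/-- Identification of `Fin 4` with the Klein four-group. -/
def pKlein : Fin 4 → ZMod 2 × ZMod 2 := ![(0, 0), (1, 0), (0, 1), (1, 1)]

/-- Additive version of a sign. -/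
def sAdd (u : ℤˣ) : ZMod 2 := if u = 1 then 0 else 1

lemma sAdd_mul : ∀ u v : ℤˣ, sAdd (u * v) = sAdd u + sAdd v := by decide

lemma pKlein_affine : ∀ g : Equiv.Perm (Fin 4), ∀ a : ZMod 2 × ZMod 2, ∃ b : ZMod 2 × ZMod 2,
    ∀ u v : Fin 4, pKlein u = a + pKlein v → pKlein (g u) = b + pKlein (g v) := by
  decide +kernel

lemma f_surj : ∀ i : Fin 4, ∀ a : ZMod 2 × ZMod 2, ∀ c : ZMod 2, ∃ g : Equiv.Perm (Fin 4),
    pKlein (g i) = a ∧ sAdd (Equiv.Perm.sign g) = c := by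
  decide +kernel

lemma fix_of_cube : ∀ h : Equiv.Perm (Fin 4), h ^ 3 = 1 → ∃ i, h i = i := by
  decide +kernel

lemma sign_of_cube (h : Equiv.Perm (Fin 4)) (hh : h ^ 3 = 1) : Equiv.Perm.sign h = 1 := by
  have h1 : (Equiv.Perm.sign h) ^ 3 = 1 := by rw [← map_pow, hh, map_one]
  have h2 : ∀ u : ℤˣ, u ^ 3 = 1 → u = 1 := by decide
  exact h2 _ h1

lemma cube_of_mem (H : Subgroup (Equiv.Perm (Fin 4))) (hH : Nat.card H = 3)
    (h : Equiv.Perm (Fin 4)) (hh : h ∈ H) : h ^ 3 = 1 := by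
  have : (⟨h, hh⟩ : H) ^ Nat.card H = 1 := pow_card_eq_one'
  rw [hH] at this
  simpa using congrArg Subtype.val this

lemma exists_fixed (H : Subgroup (Equiv.Perm (Fin 4))) (hH : Nat.card H = 3) :
    ∃ i : Fin 4, ∀ h ∈ H, h i = i := by
  have : Fact (Nat.Prime 3) := ⟨Nat.prime_three⟩
  have : Nontrivial H := Finite.one_lt_card_iff_nontrivial.1 (by omega)
  obtain ⟨x, hx⟩ := exists_ne (1 : H)
  obtain ⟨i, hi⟩ := fix_of_cube x (cube_of_mem H hH x x.2)
  refine ⟨i, fun h hh => ?_⟩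
  obtain ⟨n, hn⟩ := Subgroup.mem_zpowers_iff.1 (mem_zpowers_of_prime_card hH hx (g' := ⟨h, hh⟩))
  have : h = (x : Equiv.Perm (Fin 4)) ^ n := by simpa using (congrArg Subtype.val hn).symm
  rw [this]
  exact Equiv.Perm.zpow_apply_eq_self_of_apply_eq_self hi n

lemma no_compl (H : Subgroup (Equiv.Perm (Fin 4))) (hH : Nat.card H = 3) :
    ¬ ∃ N : Subgroup (Equiv.Perm (Fin 4)), IsNormalComplement N H := by
  rintro ⟨N, hN, hi, hm⟩
  have htop : N = ⊤ := by
    rw [eq_top_iff, ← Equiv.Perm.closure_isSwap, Subgroup.closure_le]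
    intro g hg
    have hgm : g ∈ (N : Set (Equiv.Perm (Fin 4))) * (H : Set (Equiv.Perm (Fin 4))) := by
      rw [hm]; trivial
    obtain ⟨n, hn, h, hh, rfl⟩ := Set.mem_mul.1 hgm
    have hsq : (n * h) * (n * h) = 1 := by
      obtain ⟨a, b, -, hab⟩ := hg
      rw [hab, Equiv.swap_mul_self]
    have h1 : n * (h * n * h⁻¹) ∈ N := N.mul_mem hn (hN.conj_mem n hn h)
    have h2 : h * h = (n * (h * n * h⁻¹))⁻¹ := by
      rw [eq_inv_iff_mul_eq_one, mul_eq_one_comm, ← hsq]; group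
    have h3 : h * h ∈ N ⊓ H := ⟨h2 ▸ N.inv_mem h1, H.mul_mem hh hh⟩
    rw [hi, Subgroup.mem_bot] at h3
    have h4 := cube_of_mem H hH h hh
    rw [pow_succ, pow_two, h3, one_mul] at h4
    subst h4
    simpa using hn
  rw [htop, top_inf_eq] at hi
  rw [hi] at hH
  simp at hH

lemma exists_equiv (H : Subgroup (Equiv.Perm (Fin 4))) (hH : Nat.card H = 3) :
    ∃ e : (Equiv.Perm (Fin 4) ⧸ H) ≃ (ZMod 2 × ZMod 2 × ZMod 2),
      ∀ (g : Equiv.Perm (Fin 4)) (a : ZMod 2 × ZMod 2 × ZMod 2),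
        ∃ b : ZMod 2 × ZMod 2 × ZMod 2, ∀ x y, e x = a + e y → e (g • x) = b + e (g • y) := by
  obtain ⟨i, hfix⟩ := exists_fixed H hH
  let F : Equiv.Perm (Fin 4) → ZMod 2 × ZMod 2 × ZMod 2 := fun g =>
    ((pKlein (g i)).1, (pKlein (g i)).2, sAdd (Equiv.Perm.sign g))
  let f : (Equiv.Perm (Fin 4) ⧸ H) → ZMod 2 × ZMod 2 × ZMod 2 := fun x =>
    Quotient.liftOn' x F (by
      intro k l hkl
      rw [QuotientGroup.leftRel_apply] at hkl
      have h1 : l = k * (k⁻¹ * l) := by group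
      have h2 : l i = k i := by
        rw [h1, Equiv.Perm.mul_apply, hfix _ hkl]
      have h3 : Equiv.Perm.sign l = Equiv.Perm.sign k := by
        rw [h1, map_mul, sign_of_cube _ (cube_of_mem H hH _ hkl), mul_one]
      simp only [F, h2, h3])
  have hf : ∀ k : Equiv.Perm (Fin 4), f (QuotientGroup.mk k) = F k := fun k => rfl
  have hsurj : Function.Surjective f := by
    rintro ⟨a, b, c⟩
    obtain ⟨g, h1, h2⟩ := f_surj i (a, b) c
    exact ⟨QuotientGroup.mk g, by rw [hf]; simp only [F, h1, h2]⟩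
  have hcard : Nat.card (Equiv.Perm (Fin 4) ⧸ H) = Nat.card (ZMod 2 × ZMod 2 × ZMod 2) := by
    have h := Subgroup.card_eq_card_quotient_mul_card_subgroup H
    rw [hH, Nat.card_perm, Nat.card_fin] at h
    have h4 : Nat.factorial 4 = 24 := rfl
    simp only [Nat.card_prod, Nat.card_zmod]
    omega
  have hbij : Function.Bijective f := (Nat.bijective_iff_surjective_and_card f).2 ⟨hsurj, hcard⟩
  refine ⟨Equiv.ofBijective f hbij, fun g a => ?_⟩
  obtain ⟨a1, a2, a3⟩ := a
  obtain ⟨b, hb⟩ := pKlein_affine g (a1, a2)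
  refine ⟨(b.1, b.2, a3), fun x y => ?_⟩
  induction x using QuotientGroup.induction_on with | H k => ?_
  induction y using QuotientGroup.induction_on with | H l => ?_
  intro hxy
  change F k = _ + F l at hxy
  change F (g * k) = _ + F (g * l)
  simp only [F, Prod.mk_add_mk, Prod.mk.injEq] at hxy
  obtain ⟨e1, e2, e3⟩ := hxy
  have := hb (k i) (l i) (Prod.ext e1 e2)
  simp only [F, Prod.mk_add_mk, Prod.mk.injEq, Equiv.Perm.mul_apply, this, Prod.fst_add,
    Prod.snd_add, map_mul, sAdd_mul, e3, true_and]
  abel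

/-- Translation action transported along an equivalence. -/
def transHom {X A : Type*} [AddCommGroup A] (e : X ≃ A) : Multiplicative A →* Equiv.Perm X where
  toFun a := (e.trans (Equiv.addLeft a.toAdd)).trans e.symm
  map_one' := by ext x; simp
  map_mul' a b := by ext x; simp [add_assoc]

lemma transHom_spec {X A : Type*} [AddCommGroup A] (e : X ≃ A) (a : Multiplicative A) (x : X) :
    e (transHom e a x) = a.toAdd + e x := by simp [transHom]

/-- For a subgroup `H` of order 3 of `S₄`: (a) `H` has no normal complement in `S₄`;
(b) there is a regular subgroup of `Sym(S₄⧸H)`, isomorphic to `(ℤ/2ℤ)³`, normalized by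
the image of the left-translation map `λ : S₄ → Sym(S₄⧸H)`. -/
theorem s4_mod_order_three_hopfGalois_not_almost_classically
    (H : Subgroup (Equiv.Perm (Fin 4))) (hH : Nat.card H = 3) :
    (¬ ∃ N : Subgroup (Equiv.Perm (Fin 4)), IsNormalComplement N H) ∧
    (∃ N : Subgroup (Equiv.Perm (Equiv.Perm (Fin 4) ⧸ H)),
      IsRegularSubgroup N ∧
      (MulAction.toPermHom (Equiv.Perm (Fin 4)) (Equiv.Perm (Fin 4) ⧸ H)).range ≤
        Subgroup.normalizer (N : Set (Equiv.Perm (Equiv.Perm (Fin 4) ⧸ H))) ∧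
      Nonempty (N ≃* Multiplicative (ZMod 2 × ZMod 2 × ZMod 2))) := by
  refine ⟨no_compl H hH, ?_⟩
  obtain ⟨e, he⟩ := exists_equiv H hH
  have hconj : ∀ g : Equiv.Perm (Fin 4), ∀ n ∈ (transHom e).range,
      MulAction.toPermHom _ (Equiv.Perm (Fin 4) ⧸ H) g * n *
        (MulAction.toPermHom _ (Equiv.Perm (Fin 4) ⧸ H) g)⁻¹ ∈ (transHom e).range := by
    rintro g _ ⟨a, rfl⟩
    obtain ⟨b, hb⟩ := he g a.toAdd
    refine ⟨Multiplicative.ofAdd b, ?_⟩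
    rw [eq_mul_inv_iff_mul_eq]
    ext x
    apply e.injective
    rw [Equiv.Perm.mul_apply, transHom_spec, Equiv.Perm.mul_apply]
    exact (hb _ _ (transHom_spec e a x)).symm
  have hinj : Function.Injective (transHom e) := by
    intro a b hab
    have h := transHom_spec e a (e.symm 0)
    rw [hab, transHom_spec] at h
    exact (Multiplicative.toAdd.injective (add_right_cancel h)).symm
  refine ⟨(transHom e).range, ⟨?_, ?_⟩, ?_, ⟨(MonoidHom.ofInjective hinj).symm⟩⟩
  · intro x y
    refine ⟨_, ⟨Multiplicative.ofAdd (e y - e x), rfl⟩, e.injective ?_⟩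
    rw [transHom_spec]; simp
  · rintro _ ⟨a, rfl⟩ x hx
    have h := transHom_spec e a x
    rw [hx] at h
    have h0 : a = 1 := Multiplicative.toAdd.injective (by simpa using h)
    rw [h0, map_one]
  · rintro _ ⟨g, rfl⟩
    rw [Subgroup.mem_normalizer_iff]
    intro n
    refine ⟨hconj g n, fun h => ?_⟩
    have h' := hconj g⁻¹ _ h
    rw [map_inv] at h'
    convert h' using 1
    group
end

section
/- Let Q_8 be the quaternion group of order 8 and let Hol(Q_8) be its holomorph, viewed as the normalizer in Sym(Q_8) of the image of the left regular representation of Q_8. Then Hol(Q_8) contains no subgroup that is isomorphic to S_4 and acts transitively on the 8-element set Q_8. -/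
/-- The holomorph of a group `N`: the normalizer in `Sym(N)` of the image of the left
regular representation of `N`. -/
def holomorph (N : Type*) [Group N] : Subgroup (Equiv.Perm N) :=
  Subgroup.normalizer ((MulAction.toPermHom N N).range : Set (Equiv.Perm N))

/-- The endomap of `Q₈` determined by the images of the two generators. -/
def phiQ (p q : QuaternionGroup 2) : QuaternionGroup 2 → QuaternionGroup 2
  | .a i => p ^ i.val
  | .xa i => q * p ^ i.val

/-- The affine map attached to a translation part and images of generators. -/
def affQ (c p q x : QuaternionGroup 2) : QuaternionGroup 2 := c * phiQ p q x

theorem holomorph_form (σ : Equiv.Perm (QuaternionGroup 2))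
    (h : σ ∈ holomorph (QuaternionGroup 2)) :
    ∃ c p q, p ^ 2 ≠ 1 ∧ ∀ x, σ x = affQ c p q x := by
  have key : ∀ n x, σ (n * x) = σ n * (σ 1)⁻¹ * σ x := by
    intro n
    have h1 := (Subgroup.mem_normalizer_iff.mp h (MulAction.toPermHom _ _ n)).mp ⟨n, rfl⟩
    obtain ⟨m, hm⟩ := h1
    have h2 : ∀ x, σ (n * x) = m * σ x := by
      intro x
      have := congrArg (fun f => f (σ x)) hm
      simpa using this.symm
    intro x
    have h3 := h2 1
    rw [mul_one] at h3
    rw [h2, h3]; group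
  let f : QuaternionGroup 2 →* QuaternionGroup 2 :=
    { toFun := fun x => (σ 1)⁻¹ * σ x
      map_one' := by simp
      map_mul' := by intro x y; rw [key]; group }
  have hf : ∀ x, σ x = σ 1 * f x := by intro x; simp [f]
  refine ⟨σ 1, f (.a 1), f (.xa 0), ?_, ?_⟩
  · intro h2
    rw [← map_pow] at h2
    have h3 := hf (.a 1 ^ 2)
    rw [h2, mul_one] at h3
    have := σ.injective h3
    revert this
    decide
  · intro x
    rw [hf x, affQ]
    congr 1
    rcases x with i | i
    · rw [phiQ, ← map_pow]
      congr 1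
      revert i; decide
    · rw [phiQ, ← map_pow, ← map_mul]
      congr 1
      revert i; decide

theorem affQ_contradiction :
    ∀ p q : QuaternionGroup 2, p ^ 2 ≠ 1 →
      (∀ x, affQ 1 p q (affQ 1 p q (affQ 1 p q x)) = x) →
      (¬ ∀ x, affQ 1 p q x = x) →
      ∀ c : QuaternionGroup 2, ∀ p' : QuaternionGroup 2, p' ^ 2 ≠ 1 →
      ∀ q' : QuaternionGroup 2,
      (∀ x, affQ c p' q' (affQ 1 p q (affQ c p' q' (affQ 1 p q x))) = x) →
      (∀ x, affQ c p' q' (affQ c p' q' (affQ c p' q' (affQ c p' q' x))) = x) →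
      ¬ (∀ x, affQ c p' q' (affQ c p' q' x) ≠ x) := by
  decide +kernel

theorem perm_four_fact : ∀ r : Equiv.Perm (Fin 4), r ^ 3 = 1 → r ≠ 1 →
    ∃ g : Equiv.Perm (Fin 4), g ^ 4 = 1 ∧ g ^ 2 ≠ 1 ∧ (g * r) ^ 2 = 1 := by
  decide +kernel

/-- The holomorph of the quaternion group `Q₈` has no transitive subgroup
isomorphic to `S₄`. -/
theorem holomorph_quaternion_no_transitive_S4 :
    ¬ ∃ S : Subgroup (Equiv.Perm (QuaternionGroup 2)),
        S ≤ holomorph (QuaternionGroup 2) ∧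
        Nonempty (S ≃* Equiv.Perm (Fin 4)) ∧
        (∀ x y : QuaternionGroup 2, ∃ σ ∈ S, σ x = y) := by
  rintro ⟨S, hS, ⟨e⟩, ht⟩
  have hpre : MulAction.IsPretransitive S (QuaternionGroup 2) :=
    ⟨fun x y => by obtain ⟨σ, h, h'⟩ := ht x y; exact ⟨⟨σ, h⟩, h'⟩⟩
  have hc : Nat.card S = 24 := by
    rw [Nat.card_congr e.toEquiv, Nat.card_eq_fintype_card]; decide
  have hst : ∀ x : QuaternionGroup 2, Nat.card (MulAction.stabilizer S x) = 3 := by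
    intro x
    have h1 := (MulAction.stabilizer S x).card_mul_index
    rw [MulAction.index_stabilizer_of_transitive, hc,
      Nat.card_eq_fintype_card (α := QuaternionGroup 2), QuaternionGroup.card] at h1
    omega
  have hcube : ∀ (x : QuaternionGroup 2) (s : S), s • x = x → s ^ 3 = 1 := by
    intro x s hs
    have := pow_card_eq_one' (x := (⟨s, hs⟩ : MulAction.stabilizer S x))
    rw [hst] at this
    exact congrArg Subtype.val this
  obtain ⟨r, hr1, hrne⟩ : ∃ r : S, r • (1 : QuaternionGroup 2) = 1 ∧ r ≠ 1 := by
    have : Nontrivial (MulAction.stabilizer S (1 : QuaternionGroup 2)) := by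
      apply (Finite.one_lt_card_iff_nontrivial).mp
      rw [hst]; norm_num
    obtain ⟨r, hr⟩ := exists_ne (1 : MulAction.stabilizer S (1 : QuaternionGroup 2))
    exact ⟨r.1, r.2, fun h => hr (Subtype.ext h)⟩
  have hr3 := hcube 1 r hr1
  obtain ⟨g', h4, h2, hgr⟩ := perm_four_fact (e r) (by rw [← map_pow, hr3, map_one])
    (by simpa using hrne)
  obtain ⟨g, rfl⟩ := e.surjective g'
  rw [← map_pow] at h4 h2
  rw [← map_mul, ← map_pow] at hgr
  have h4 : g ^ 4 = 1 := e.map_eq_one_iff.mp h4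
  have h2 : g ^ 2 ≠ 1 := fun h => h2 (e.map_eq_one_iff.mpr h)
  have hgr : (g * r) ^ 2 = 1 := e.map_eq_one_iff.mp hgr
  have hfree : ∀ x : QuaternionGroup 2, g ^ 2 • x ≠ x := by
    intro x hx
    have h6 := hcube x _ hx
    apply h2
    calc g ^ 2 = (g ^ 2) ^ 3 * (g ^ 4)⁻¹ := by group
      _ = 1 := by rw [h6, h4]; simp
  obtain ⟨c, p, q, hp, hrf⟩ := holomorph_form r.1 (hS r.2)
  obtain ⟨c', p', q', hp', hgf⟩ := holomorph_form g.1 (hS g.2)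
  have hc1 : c = 1 := by
    have h := hrf 1
    have h' : r.1 1 = 1 := hr1
    rw [h'] at h
    have h0 : phiQ p q 1 = 1 := pow_zero p
    rw [affQ, h0, mul_one] at h
    exact h.symm
  subst hc1
  refine affQ_contradiction p q hp ?_ ?_ c' p' hp' q' ?_ ?_ ?_
  · intro x
    simp only [← hrf]
    exact congrArg (fun s : S => s.1 x) hr3
  · intro h
    apply hrne
    ext x
    rw [hrf, h]; rfl
  · intro x
    simp only [← hrf, ← hgf]
    exact congrArg (fun s : S => s.1 x) hgr
  · intro x
    simp only [← hgf]
    exact congrArg (fun s : S => s.1 x) h4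
  · intro x
    simp only [← hgf]
    exact hfree x
end

section
/- Let G be the Frobenius group F_5 of order 20, realized as the semidirect product (ℤ/5ℤ) ⋊ (ℤ/5ℤ)ˣ where the unit group acts by multiplication, let H be a subgroup of G of order 2, and let λ : G → Sym(G⧸H) be the homomorphism given by left translation on left cosets. Then there exist regular subgroups N₁ and N₂ of Sym(G⧸H), each normalized by λ(G), with N₁ isomorphic to the cyclic group of order 10 and N₂ isomorphic to the dihedral group of order 10. -/
/-- The action of the units of `ℤ/5ℤ` on the (multiplicatively written) group `ℤ/5ℤ`
by multiplication, as a map to automorphisms. -/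
def unitsAction : (ZMod 5)ˣ →* MulAut (Multiplicative (ZMod 5)) where
  toFun u := AddEquiv.toMultiplicative (AddAut.mulLeft u)
  map_one' := by ext x; simp [AddAut.mulLeft]
  map_mul' u v := by ext x; simp [AddAut.mulLeft, mul_smul]

/-- The Frobenius group `F₅` of order 20: the semidirect product
`(ℤ/5ℤ) ⋊ (ℤ/5ℤ)ˣ` with the units acting by multiplication. -/
abbrev F5 := SemidirectProduct (Multiplicative (ZMod 5)) (ZMod 5)ˣ unitsAction

open MulAction in
lemma key_transport {G M X Y : Type*} [Group G] [Group M] [MulAction G X] [MulAction G Y]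
    [MulAction M Y] [Nonempty Y] (e : X ≃ Y) (he : ∀ (g : G) x, e (g • x) = g • e x)
    (tr : ∀ y y' : Y, ∃ m : M, m • y = y') (fr : ∀ (m : M) (y : Y), m • y = y → m = 1)
    (nm : ∀ (g : G) (m : M), ∃ m' : M, ∀ y : Y, g • m • y = m' • g • y) :
    ∃ N : Subgroup (Equiv.Perm X), IsRegularSubgroup N ∧
      (MulAction.toPermHom G X).range ≤ Subgroup.normalizer (N : Set (Equiv.Perm X)) ∧
      Nonempty (N ≃* M) := by
  let f : M →* Equiv.Perm X := (e.symm.permCongrHom.toMonoidHom).comp (toPermHom M Y)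
  have hf : ∀ m x, f m x = e.symm (m • e x) := fun m x => rfl
  have hinj : Function.Injective f := by
    rw [injective_iff_map_eq_one]
    intro m hm
    obtain ⟨y⟩ := ‹Nonempty Y›
    apply fr m y
    have := hf m (e.symm y)
    rw [hm] at this
    simpa using this.symm
  have hconj : ∀ (g : G) (σ : Equiv.Perm X), σ ∈ f.range →
      toPermHom G X g * σ * (toPermHom G X g)⁻¹ ∈ f.range := by
    rintro g _ ⟨m, rfl⟩
    obtain ⟨m', hm'⟩ := nm g m
    refine ⟨m', ?_⟩
    rw [eq_mul_inv_iff_mul_eq]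
    ext x
    apply e.injective
    simp [hf, he, hm']
  refine ⟨f.range, ⟨?_, ?_⟩, ?_, ⟨(MonoidHom.ofInjective hinj).symm⟩⟩
  · intro x y
    obtain ⟨m, hm⟩ := tr (e x) (e y)
    exact ⟨f m, ⟨m, rfl⟩, by rw [hf, hm]; simp⟩
  · rintro _ ⟨m, rfl⟩ x hx
    rw [fr m (e x) (by rw [hf, Equiv.symm_apply_eq] at hx; exact hx), map_one]
  · rintro _ ⟨g, rfl⟩
    rw [Subgroup.mem_normalizer_iff]
    intro σ
    refine ⟨hconj g σ, fun h => ?_⟩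
    have := hconj g⁻¹ _ h
    rw [map_inv] at this
    simpa [mul_assoc] using this

/-- The model of the coset space: `ℤ/5ℤ × ℤ/2ℤ`. -/
abbrev YY := ZMod 5 × ZMod 2

/-- The quadratic character, written additively. -/
def chi (u : (ZMod 5)ˣ) : ZMod 2 := if u * u = 1 then 0 else 1

lemma chi_one : chi 1 = 0 := by decide
lemma chi_mul : ∀ u v, chi (u * v) = chi u + chi v := by decide

/-- The action of `F5` on the model. -/
@[reducible] def actF : MulAction F5 YY where
  smul g y := (g.left.toAdd + g.right * y.1, chi g.right + y.2)
  one_smul y := by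
    change ((1 : F5).left.toAdd + ((1 : F5).right : ZMod 5) * y.1, chi (1 : F5).right + y.2) = y
    simp [chi_one]
  mul_smul g h y := by
    change ((g * h).left.toAdd + ((g * h).right : ZMod 5) * y.1, chi (g * h).right + y.2) =
      (g.left.toAdd + g.right * (h.left.toAdd + h.right * y.1),
        chi g.right + (chi h.right + y.2))
    have : (unitsAction g.right h.left).toAdd = (g.right : ZMod 5) * h.left.toAdd := rfl
    simp only [SemidirectProduct.mul_left, SemidirectProduct.mul_right, toAdd_mul, this, chi_mul,
      Units.val_mul]
    ext <;> simp <;> ring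

/-- The cyclic action. -/
@[reducible] def actC : MulAction (Multiplicative (ZMod 10)) YY where
  smul n y := (ZMod.castHom (by norm_num : 5 ∣ 10) (ZMod 5) n.toAdd + y.1,
    ZMod.castHom (by norm_num : 2 ∣ 10) (ZMod 2) n.toAdd + y.2)
  one_smul y := by
    change (ZMod.castHom (by norm_num : 5 ∣ 10) (ZMod 5) 0 + y.1,
      ZMod.castHom (by norm_num : 2 ∣ 10) (ZMod 2) 0 + y.2) = y
    simp
  mul_smul m n y := by
    change (ZMod.castHom (by norm_num : 5 ∣ 10) (ZMod 5) (m.toAdd + n.toAdd) + y.1,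
      ZMod.castHom (by norm_num : 2 ∣ 10) (ZMod 2) (m.toAdd + n.toAdd) + y.2) =
      (ZMod.castHom (by norm_num : 5 ∣ 10) (ZMod 5) m.toAdd +
        (ZMod.castHom (by norm_num : 5 ∣ 10) (ZMod 5) n.toAdd + y.1),
      ZMod.castHom (by norm_num : 2 ∣ 10) (ZMod 2) m.toAdd +
        (ZMod.castHom (by norm_num : 2 ∣ 10) (ZMod 2) n.toAdd + y.2))
    rw [map_add, map_add, add_assoc, add_assoc]

/-- The dihedral action on the model, as a function. -/
def dFun : DihedralGroup 5 → YY → YY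
  | .r i, y => (i + y.1, y.2)
  | .sr i, y => (-i - y.1, 1 + y.2)

/-- The dihedral action. -/
@[reducible] def actD : MulAction (DihedralGroup 5) YY where
  smul := dFun
  one_smul y := by
    change dFun (.r 0) y = y
    simp [dFun]
  mul_smul m n y := by
    change dFun (m * n) y = dFun m (dFun n y)
    have h2 : ∀ z : ZMod 2, z = 1 + (1 + z) := by decide
    rcases m with i | i <;> rcases n with j | j <;> ext <;> simp [dFun]
    all_goals first | exact h2 _ | ring

lemma unit_aux : ∀ u : (ZMod 5)ˣ, u * u = 1 → u = 1 ∨ u = -1 := by decide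

lemma chi_aux : ∀ v : (ZMod 5)ˣ, chi v + 0 = 0 ↔ v = 1 ∨ v = -1 := by decide

lemma fix_aux : ∀ a b : ZMod 5, b + (-1) * (3 * a) = 3 * a ↔ b = a := by decide

lemma stab_aux (a : ZMod 5) (u : (ZMod 5)ˣ) (h1 : ¬ (a = 0 ∧ u = 1)) (h2 : a + u * a = 0)
    (h3 : u * u = 1) :
    ∃ p : ZMod 5, ∀ (b : ZMod 5) (v : (ZMod 5)ˣ), (b + v * p = p ∧ chi v + 0 = 0) ↔
      ((b = 0 ∧ v = 1) ∨ (b = a ∧ v = u)) := by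
  have hne : (1 : (ZMod 5)ˣ) ≠ -1 := by decide
  rcases unit_aux u h3 with rfl | rfl
  · exfalso
    have : ∀ a : ZMod 5, a + 1 * a = 0 → a = 0 := by decide
    exact h1 ⟨this a (by simpa using h2), rfl⟩
  · refine ⟨3 * a, fun b v => ?_⟩
    rw [chi_aux]
    constructor
    · rintro ⟨hb, rfl | rfl⟩
      · left; simpa using hb
      · right; exact ⟨(fix_aux a b).1 (by simpa using hb), rfl⟩
    · rintro (⟨rfl, rfl⟩ | ⟨rfl, rfl⟩)
      · simp
      · exact ⟨by simpa using (fix_aux b b).2 rfl, Or.inr rfl⟩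

/-- For a subgroup `H` of order 2 of the Frobenius group `F₅` of order 20, the coset space
`F₅⧸H` carries regular subgroups normalized by the left-translation image of `F₅`,
one cyclic of order 10 and one dihedral of order 10. -/
theorem F5_mod_order_two_two_hopfGalois_structures
    (H : Subgroup F5) (hH : Nat.card H = 2) :
    ∃ N₁ N₂ : Subgroup (Equiv.Perm (F5 ⧸ H)),
      IsRegularSubgroup N₁ ∧
      (MulAction.toPermHom F5 (F5 ⧸ H)).range ≤ Subgroup.normalizer (N₁ : Set (Equiv.Perm (F5 ⧸ H))) ∧
      Nonempty (N₁ ≃* Multiplicative (ZMod 10)) ∧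
      IsRegularSubgroup N₂ ∧
      (MulAction.toPermHom F5 (F5 ⧸ H)).range ≤ Subgroup.normalizer (N₂ : Set (Equiv.Perm (F5 ⧸ H))) ∧
      Nonempty (N₂ ≃* DihedralGroup 5) := by
  classical
  letI := actF
  letI := actC
  letI := actD
  have sF : ∀ (g : F5) (y : YY), g • y = (g.left.toAdd + g.right * y.1, chi g.right + y.2) :=
    fun _ _ => rfl
  -- the point stabilized by `H`
  obtain ⟨y0, hy0⟩ : ∃ y0 : YY, H = MulAction.stabilizer F5 y0 := by
    obtain ⟨x, hx⟩ := Nat.card_eq_two_iff' (1 : H) |>.1 hH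
    obtain ⟨hx1, hx2⟩ := hx
    have hxx : x * x = 1 := by
      by_contra hne
      have := hx2 _ hne
      exact hx1 (by simpa using this)
    have hall : ∀ g : F5, g ∈ H ↔ g = 1 ∨ g = x := by
      intro g
      constructor
      · intro hg
        by_cases h1 : (⟨g, hg⟩ : H) = 1
        · left; exact congrArg Subtype.val h1
        · right; exact congrArg Subtype.val (hx2 _ h1)
      · rintro (rfl | rfl)
        · exact H.one_mem
        · exact x.2
    have e1 : (x : F5) * x = 1 := congrArg Subtype.val hxx
    have hx1' : (x : F5) ≠ 1 := fun h => hx1 (Subtype.ext h)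
    generalize (x : F5) = h at e1 hx1' hall
    have el : h.left.toAdd + h.right * h.left.toAdd = 0 :=
      congrArg (fun z : F5 => z.left.toAdd) e1
    have er : h.right * h.right = 1 := congrArg (fun z : F5 => z.right) e1
    have ext' : ∀ g k : F5, g = k ↔ g.left.toAdd = k.left.toAdd ∧ g.right = k.right := by
      intro g k
      rw [SemidirectProduct.ext_iff]; rfl
    obtain ⟨p, hp⟩ := stab_aux h.left.toAdd h.right
      (fun hh => hx1' ((ext' _ _).2 hh)) el er
    refine ⟨(p, 0), ?_⟩
    ext g
    rw [hall, MulAction.mem_stabilizer_iff, sF, Prod.ext_iff, ext' g 1, ext' g h]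
    exact (hp g.left.toAdd g.right).symm
  subst hy0
  have htrF : ∀ y : YY, ∃ g : F5, g • y0 = y := by
    intro y
    have : ∀ s t : ZMod 2, ∃ u : (ZMod 5)ˣ, chi u + s = t := by decide
    obtain ⟨u, hu⟩ := this y0.2 y.2
    refine ⟨⟨Multiplicative.ofAdd (y.1 - u * y0.1), u⟩, ?_⟩
    rw [sF]
    ext
    · simp
    · exact hu
  let e : F5 ⧸ MulAction.stabilizer F5 y0 ≃ YY :=
    Equiv.ofBijective (MulAction.ofQuotientStabilizer F5 y0)
      ⟨MulAction.injective_ofQuotientStabilizer F5 y0, fun y => by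
        obtain ⟨g, hg⟩ := htrF y
        exact ⟨(g : F5 ⧸ MulAction.stabilizer F5 y0), hg⟩⟩
  have he : ∀ (g : F5) x, e (g • x) = g • e x := fun g x =>
    MulAction.ofQuotientStabilizer_smul F5 y0 g x
  obtain ⟨N₁, a1, a2, a3⟩ := key_transport (M := Multiplicative (ZMod 10)) e he
    (by
      intro y y'
      have : ∀ (b : ZMod 5) (s : ZMod 2), ∃ n : ZMod 10,
        ZMod.castHom (by norm_num : 5 ∣ 10) (ZMod 5) n = b ∧
        ZMod.castHom (by norm_num : 2 ∣ 10) (ZMod 2) n = s := by decide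
      obtain ⟨n, h1, h2⟩ := this (y'.1 - y.1) (y'.2 - y.2)
      refine ⟨Multiplicative.ofAdd n, ?_⟩
      change (ZMod.castHom (by norm_num : 5 ∣ 10) (ZMod 5) n + y.1,
        ZMod.castHom (by norm_num : 2 ∣ 10) (ZMod 2) n + y.2) = y'
      rw [h1, h2]; simp)
    (by
      intro n y h
      have : ∀ n : ZMod 10, ZMod.castHom (by norm_num : 5 ∣ 10) (ZMod 5) n = 0 →
        ZMod.castHom (by norm_num : 2 ∣ 10) (ZMod 2) n = 0 → n = 0 := by decide
      have h1 := congrArg Prod.fst h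
      have h2 := congrArg Prod.snd h
      exact this n.toAdd (add_eq_right.1 h1) (add_eq_right.1 h2))
    (by
      intro g n
      have : ∀ (u : ZMod 5) (n : ZMod 10), ∃ n' : ZMod 10,
        ZMod.castHom (by norm_num : 5 ∣ 10) (ZMod 5) n' =
          u * ZMod.castHom (by norm_num : 5 ∣ 10) (ZMod 5) n ∧
        ZMod.castHom (by norm_num : 2 ∣ 10) (ZMod 2) n' =
          ZMod.castHom (by norm_num : 2 ∣ 10) (ZMod 2) n := by decide
      obtain ⟨n', h1, h2⟩ := this g.right n.toAdd
      refine ⟨Multiplicative.ofAdd n', fun y => ?_⟩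
      change (g.left.toAdd + (g.right : ZMod 5) *
          (ZMod.castHom (by norm_num : 5 ∣ 10) (ZMod 5) n.toAdd + y.1),
          chi g.right + (ZMod.castHom (by norm_num : 2 ∣ 10) (ZMod 2) n.toAdd + y.2)) =
        (ZMod.castHom (by norm_num : 5 ∣ 10) (ZMod 5) n' +
          (g.left.toAdd + (g.right : ZMod 5) * y.1),
          ZMod.castHom (by norm_num : 2 ∣ 10) (ZMod 2) n' + (chi g.right + y.2))
      rw [h1, h2]
      ext
      · dsimp only; ring
      · dsimp only; ring)
  obtain ⟨N₂, b1, b2, b3⟩ := key_transport (M := DihedralGroup 5) e he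
    (by
      intro y y'
      have : ∀ s t : ZMod 2, t = s ∨ t = 1 + s := by decide
      rcases this y.2 y'.2 with h | h
      · refine ⟨.r (y'.1 - y.1), ?_⟩
        change (y'.1 - y.1 + y.1, y.2) = y'
        rw [← h]; simp
      · refine ⟨.sr (-y'.1 - y.1), ?_⟩
        change (-(-y'.1 - y.1) - y.1, 1 + y.2) = y'
        rw [← h]; simp)
    (by
      rintro (i | i) y h
      · have h1 : i + y.1 = y.1 := congrArg Prod.fst h
        rw [add_eq_right.1 h1]; rfl
      · have h1 : 1 + y.2 = y.2 := congrArg Prod.snd h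
        exact absurd (add_eq_right.1 h1) (by decide))
    (by
      rintro g (i | i)
      · refine ⟨.r (g.right * i), fun y => ?_⟩
        change (g.left.toAdd + (g.right : ZMod 5) * (i + y.1), chi g.right + y.2) =
          ((g.right : ZMod 5) * i + (g.left.toAdd + (g.right : ZMod 5) * y.1), chi g.right + y.2)
        ext
        · dsimp only; ring
        · rfl
      · refine ⟨.sr (g.right * i - 2 * g.left.toAdd), fun y => ?_⟩
        change (g.left.toAdd + (g.right : ZMod 5) * (-i - y.1), chi g.right + (1 + y.2)) =
          (-((g.right : ZMod 5) * i - 2 * g.left.toAdd) -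
            (g.left.toAdd + (g.right : ZMod 5) * y.1), 1 + (chi g.right + y.2))
        ext
        · dsimp only; ring
        · dsimp only; ring)
  exact ⟨N₁, N₂, a1, a2, a3, b1, b2, b3⟩
end

section
/- The holomorph of the dihedral group of order 12 is isomorphic to the holomorph of the dicyclic group of order 12: Hol(DihedralGroup 6) ≅ Hol(QuaternionGroup 3), and both have order 144. -/
namespace HolAux

/-- A permutation is in the holomorph iff it is a heap automorphism of `N`. -/
lemma mem_holomorph_iff {N : Type*} [Group N] [Finite N] (p : Equiv.Perm N) :
    p ∈ holomorph N ↔ ∀ x y, p (x * y) = p x * (p 1)⁻¹ * p y := by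
  unfold holomorph
  constructor
  · intro h x y
    rw [Subgroup.mem_normalizer_iff] at h
    have h1 := (h (MulAction.toPermHom N N x)).1 ⟨x, rfl⟩
    obtain ⟨z, hz⟩ := h1
    have key : ∀ w, z * p w = p (x * w) := by
      intro w
      have := congrArg (fun q : Equiv.Perm N => q (p w)) hz
      simpa using this
    rw [← key y, ← mul_one x, ← key 1]
    group
  · intro h
    have key : ∀ q : Equiv.Perm N, q ∈ (MulAction.toPermHom N N).range →
        p * q * p⁻¹ ∈ (MulAction.toPermHom N N).range := by
      rintro _ ⟨x, rfl⟩
      refine ⟨p x * (p 1)⁻¹, ?_⟩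
      ext w
      have := h x (p.symm w)
      simpa using this.symm
    exact Subgroup.mem_normalizer_fintype key

abbrev P := ℤˣ × ZMod (2 * 3) × ZMod (2 * 3) × Bool

abbrev D := DihedralGroup (2 * 3)
abbrev Q := QuaternionGroup 3

def fD (t : P) : D → D
  | .r i => match t with
    | (u, b, _, false) => .r (((u : ℤ) : ZMod (2 * 3)) * i + b)
    | (u, b, _, true) => .sr (((u : ℤ) : ZMod (2 * 3)) * i + b)
  | .sr i => match t with
    | (u, _, c, false) => .sr (((u : ℤ) : ZMod (2 * 3)) * i + c)
    | (u, _, c, true) => .r (((u : ℤ) : ZMod (2 * 3)) * i + c)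

def phi : D ≃ Q where
  toFun
    | .r i => .a i
    | .sr i => .xa i
  invFun
    | .a i => .r i
    | .xa i => .sr i
  left_inv := by rintro (i | i) <;> rfl
  right_inv := by rintro (i | i) <;> rfl

def fQ (t : P) (x : Q) : Q := phi (fD t (phi.symm x))

lemma fD_inj (t : P) : Function.Injective (fD t) := by
  obtain ⟨u, b, c, e⟩ := t
  rcases Int.units_eq_one_or u with rfl | rfl <;> cases e <;> rintro (i | i) (j | j) h <;>
    simp_all [fD]

noncomputable def FD (t : P) : Equiv.Perm D :=
  Equiv.ofBijective (fD t) (Finite.injective_iff_bijective.1 (fD_inj t))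

@[simp] lemma FD_apply (t : P) (x : D) : FD t x = fD t x := rfl

lemma FD_injective : Function.Injective FD := by
  intro t t' h
  have h0 : fD t (.r 0) = fD t' (.r 0) := congrArg (fun q : Equiv.Perm D => q (.r 0)) h
  have h1 : fD t (.r 1) = fD t' (.r 1) := congrArg (fun q : Equiv.Perm D => q (.r 1)) h
  have h2 : fD t (.sr 0) = fD t' (.sr 0) := congrArg (fun q : Equiv.Perm D => q (.sr 0)) h
  have n1 : (1 : ZMod (2 * 3)) ≠ -1 := by decide
  have n2 : (-1 : ZMod (2 * 3)) ≠ 1 := by decide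
  obtain ⟨u, b, c, e⟩ := t
  obtain ⟨u', b', c', e'⟩ := t'
  rcases Int.units_eq_one_or u with rfl | rfl <;> rcases Int.units_eq_one_or u' with rfl | rfl <;>
    cases e <;> cases e' <;> simp_all [fD]

lemma card_P : Nat.card P = 144 := by
  simp [P, Nat.card_eq_fintype_card]

lemma FD_mem (t : P) : FD t ∈ holomorph D := by
  rw [mem_holomorph_iff]
  obtain ⟨u, b, c, e⟩ := t
  rcases Int.units_eq_one_or u with rfl | rfl <;> cases e <;> rintro (i | i) (j | j) <;>
    simp [fD, DihedralGroup.one_def, -DihedralGroup.r_zero] <;> ring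

lemma FQ_mem (t : P) : phi.permCongr (FD t) ∈ holomorph Q := by
  rw [mem_holomorph_iff]
  have h3 : (3 : ZMod (2 * 3)) + 3 = 0 := by decide
  have ai : ∀ b, (QuaternionGroup.a b : Q)⁻¹ = .a (-b) := by decide
  have xi : ∀ b, (QuaternionGroup.xa b : Q)⁻¹ = .xa (3 + b) := by decide
  obtain ⟨u, b, c, e⟩ := t
  rcases Int.units_eq_one_or u with rfl | rfl <;> cases e <;> rintro (i | i) (j | j) <;>
    simp [ai, xi, fD, phi, QuaternionGroup.one_def, -DihedralGroup.r_zero, -QuaternionGroup.a_zero] <;> grind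

/-- The endomorphism attached to an element of the holomorph. -/
lemma exists_hom {N : Type*} [Group N] [Finite N] (p : Equiv.Perm N) (hp : p ∈ holomorph N) :
    ∃ α : N →* N, Function.Injective α ∧ ∀ x, p x = p 1 * α x := by
  rw [mem_holomorph_iff] at hp
  refine ⟨⟨⟨fun x => (p 1)⁻¹ * p x, by simp⟩, fun x y => ?_⟩, fun x y h => ?_, fun x => ?_⟩
  · simp [hp x y, mul_assoc]
  · simpa using h
  · simp

lemma homD : ∀ x y : D, (∀ i : ZMod (2 * 3), i ≠ 0 → x ^ i.val ≠ 1) →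
    (∀ i : ZMod (2 * 3), y ≠ x ^ i.val) →
    ∃ u : ℤˣ, ∃ v, x = .r ((u : ℤ) : ZMod (2 * 3)) ∧ y = .sr v := by
  decide

lemma homQ : ∀ x y : Q, (∀ i : ZMod (2 * 3), i ≠ 0 → x ^ i.val ≠ 1) →
    (∀ i : ZMod (2 * 3), y ≠ x ^ i.val) →
    ∃ u : ℤˣ, ∃ v, x = .a ((u : ℤ) : ZMod (2 * 3)) ∧ y = .xa v := by
  decide

lemma r_pow (k i : ZMod (2 * 3)) : (.r k : D) ^ i.val = .r (k * i) := by
  revert k i; decide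

lemma a_pow (k i : ZMod (2 * 3)) : (.a k : Q) ^ i.val = .a (k * i) := by
  revert k i; decide

lemma FD_surj (p : Equiv.Perm D) (hp : p ∈ holomorph D) : ∃ t, FD t = p := by
  obtain ⟨α, hα, h⟩ := exists_hom p hp
  have hr : ∀ i, α (.r i) = α (.r 1) ^ i.val := fun i => by rw [← map_pow, r_pow, one_mul]
  have hs : ∀ i, α (.sr i) = α (.sr 0) * α (.r i) := fun i => by rw [← map_mul]; simp
  obtain ⟨u, v, hu, hv⟩ := homD (α (.r 1)) (α (.sr 0))
    (fun i hi he => by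
      rw [← hr, ← map_one α] at he
      have := hα he
      simp [DihedralGroup.one_def, -DihedralGroup.r_zero] at this
      exact hi this)
    (fun i he => by
      rw [← hr] at he
      simpa using hα he)
  have hr' : ∀ i, α (.r i) = .r ((u : ℤ) * i) := fun i => by rw [hr, hu, r_pow]
  have hs' : ∀ i, α (.sr i) = .sr (v + (u : ℤ) * i) := fun i => by rw [hs, hv, hr']; simp
  rcases h1 : p 1 with b | b
  · refine ⟨(u, b, v - b, false), ?_⟩
    ext x
    rw [h x, h1, FD_apply]
    rcases x with i | i
    · simp [fD, hr']; ring
    · simp [fD, hs']; ring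
  · refine ⟨(u, b, v - b, true), ?_⟩
    ext x
    rw [h x, h1, FD_apply]
    rcases x with i | i
    · simp [fD, hr']; ring
    · simp [fD, hs']; ring

lemma FQ_surj (p : Equiv.Perm Q) (hp : p ∈ holomorph Q) : ∃ t, phi.permCongr (FD t) = p := by
  obtain ⟨α, hα, h⟩ := exists_hom p hp
  have hr : ∀ i, α (.a i) = α (.a 1) ^ i.val := fun i => by rw [← map_pow, a_pow, one_mul]
  have hs : ∀ i, α (.xa i) = α (.xa 0) * α (.a i) := fun i => by rw [← map_mul]; simp
  obtain ⟨u, v, hu, hv⟩ := homQ (α (.a 1)) (α (.xa 0))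
    (fun i hi he => by
      rw [← hr, ← map_one α] at he
      have := hα he
      simp [QuaternionGroup.one_def, -QuaternionGroup.a_zero] at this
      exact hi this)
    (fun i he => by
      rw [← hr] at he
      simpa using hα he)
  have hr' : ∀ i, α (.a i) = .a ((u : ℤ) * i) := fun i => by rw [hr, hu, a_pow]
  have hs' : ∀ i, α (.xa i) = .xa (v + (u : ℤ) * i) := fun i => by rw [hs, hv, hr']; simp
  rcases h1 : p 1 with b | b
  · refine ⟨(u, b, v - b, false), ?_⟩
    ext x
    rw [h x, h1, Equiv.permCongr_apply, FD_apply]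
    rcases x with i | i
    · simp [fD, phi, hr']; ring
    · simp [fD, phi, hs']; ring
  · refine ⟨(u, b, 3 + v - b, true), ?_⟩
    ext x
    rw [h x, h1, Equiv.permCongr_apply, FD_apply]
    rcases x with i | i
    · simp [fD, phi, hr']; ring
    · simp [fD, phi, hs']; ring

lemma card_D : Nat.card (holomorph D) = 144 := by
  rw [← card_P]
  refine (Nat.card_eq_of_bijective (fun t : P => (⟨FD t, FD_mem t⟩ : holomorph D)) ⟨?_, ?_⟩).symm
  · intro t t' h
    exact FD_injective (congrArg Subtype.val h)
  · rintro ⟨p, hp⟩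
    obtain ⟨t, rfl⟩ := FD_surj p hp
    exact ⟨t, rfl⟩

lemma map_eq : (holomorph D).map (phi.permCongrHom : Equiv.Perm D →* Equiv.Perm Q)
    = holomorph Q := by
  ext p
  constructor
  · rintro ⟨q, hq, rfl⟩
    obtain ⟨t, rfl⟩ := FD_surj q hq
    exact FQ_mem t
  · intro hp
    obtain ⟨t, rfl⟩ := FQ_surj p hp
    exact ⟨FD t, FD_mem t, rfl⟩

noncomputable def iso : holomorph D ≃* holomorph Q :=
  (phi.permCongrHom.subgroupMap (holomorph D)).trans (MulEquiv.subgroupCongr map_eq)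

end HolAux
/-- The holomorphs of the dihedral group of order 12 and of the dicyclic group of order
12 are isomorphic, and both have order 144. -/
theorem holomorph_D12_iso_holomorph_Dic3 :
    Nonempty (holomorph (DihedralGroup 6) ≃* holomorph (QuaternionGroup 3)) ∧
    Nat.card (holomorph (DihedralGroup 6)) = 144 ∧
    Nat.card (holomorph (QuaternionGroup 3)) = 144 := by
  exact ⟨⟨HolAux.iso⟩, HolAux.card_D, (Nat.card_congr HolAux.iso.toEquiv).symm.trans HolAux.card_D⟩
end

section
/- Let G = S_3 × S_3 and let H = ⟨(c₁, c₂)⟩ where c₁ and c₂ are elements of order 3 of S_3, so that H has order 3 and is core-free in G. Let λ : G → Sym(G⧸H) be the homomorphism given by left translation on left cosets. Then: (a) H has no normal complement in G (indeed G has no normal subgroup of order 12); and (b) there exist regular subgroups of Sym(G⧸H) normalized by λ(G), one isomorphic to the dihedral group of order 12 and one isomorphic to the dicyclic group Dic_3 of order 12. -/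
open Pointwise

/-- Short name for the symmetric group on three letters. -/
abbrev S3 := Equiv.Perm (Fin 3)

/-- A fixed transposition. -/
def tau : S3 := Equiv.swap 0 1

/-- A fixed three-cycle. -/
def rot : S3 := finRotate 3

theorem order_three_cases : ∀ c : S3, orderOf c = 3 → c = rot ∨ c = rot⁻¹ := by
  have key : ∀ c : S3, c ^ 3 = 1 → c ≠ 1 → c = rot ∨ c = rot⁻¹ := by decide
  intro c hc
  refine key c (orderOf_dvd_iff_pow_eq_one.1 hc.dvd) ?_
  rintro rfl
  simp at hc

theorem mem_H_iff (c₁ c₂ : S3) (h₁ : orderOf c₁ = 3) (h₂ : orderOf c₂ = 3) (h : S3 × S3) :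
    h ∈ Subgroup.zpowers (c₁, c₂) ↔ h = 1 ∨ h = (c₁, c₂) ∨ h = (c₁⁻¹, c₂⁻¹) := by
  constructor
  · intro hh
    have p : (c₁, c₂) ^ 3 = 1 := by
      rw [Prod.pow_mk, orderOf_dvd_iff_pow_eq_one.1 h₁.dvd, orderOf_dvd_iff_pow_eq_one.1 h₂.dvd]
      rfl
    obtain ⟨k, rfl⟩ := Subgroup.mem_zpowers_iff.1 hh
    have e : (c₁, c₂) ^ k = (c₁, c₂) ^ (k % 3) := by
      conv_lhs => rw [← Int.emod_add_mul_ediv k 3]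
      rw [zpow_add, zpow_mul]
      have : (c₁, c₂) ^ (3 : ℤ) = 1 := by exact_mod_cast p
      rw [this, one_zpow, mul_one]
    have hk : k % 3 = 0 ∨ k % 3 = 1 ∨ k % 3 = 2 := by omega
    rw [e]
    rcases hk with hk | hk | hk <;> rw [hk]
    · left; simp
    · right; left; simp
    · right; right
      have : (c₁, c₂) ^ (2 : ℤ) = (c₁, c₂)⁻¹ := by
        rw [eq_inv_iff_mul_eq_one, ← zpow_add_one]
        exact_mod_cast p
      rw [this]; rfl
  · rintro (rfl | rfl | rfl)
    · exact one_mem _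
    · exact Subgroup.mem_zpowers _
    · exact inv_mem (Subgroup.mem_zpowers (c₁, c₂))

theorem no_normal_twelve (K : Subgroup (S3 × S3)) (hK : K.Normal) : Nat.card K ≠ 12 := by
  intro hc
  have hG : Nat.card (S3 × S3) = 36 := by
    rw [Nat.card_eq_fintype_card]; decide
  have hi : K.index = 3 := by
    have := K.card_mul_index
    rw [hc, hG] at this; omega
  have hinv : ∀ g : S3 × S3, g ^ 3 = g → g ∈ K := by
    intro g hg
    have := K.pow_index_mem g
    rwa [hi, hg] at this
  have hall : ∀ a : S3, ∃ x y : S3, x ^ 3 = x ∧ y ^ 3 = y ∧ x * y = a := by decide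
  have htop : K = ⊤ := by
    rw [eq_top_iff]
    rintro ⟨a, b⟩ -
    obtain ⟨x, y, hx, hy, rfl⟩ := hall a
    obtain ⟨z, w, hz, hw, rfl⟩ := hall b
    exact mul_mem (hinv (x, z) (by rw [Prod.pow_mk, hx, hz]))
      (hinv (y, w) (by rw [Prod.pow_mk, hy, hw]))
  rw [htop, Subgroup.card_top, hG] at hc
  omega

/-- The parity of an element of `S₃ × S₃`. -/
def par (g : S3 × S3) : ℤˣ := Equiv.Perm.sign g.1 * Equiv.Perm.sign g.2

theorem par_mul (g h : S3 × S3) : par (g * h) = par g * par h := by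
  simp only [par, Prod.fst_mul, Prod.snd_mul, map_mul]
  exact mul_mul_mul_comm _ _ _ _

/-- Twisted action data: `d` acts by `gH ↦ (σ d, 1) g (e d p, e d p) H`, `p` the parity of `g`. -/
structure Dat (A : Type) [Group A] where
  σ : A → S3
  e : A → ℤˣ → S3
  σ_one : σ 1 = 1
  σ_mul : ∀ d d', σ (d * d') = σ d * σ d'
  e_val : ∀ d p, e d p = 1 ∨ e d p = tau
  e_one : ∀ p, e 1 p = 1
  e_mul : ∀ d d' p, e (d * d') p = e d' p * e d (Equiv.Perm.sign (σ d') * p)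
  free : ∀ d p, σ d = 1 → e d p = 1 → d = 1
  conj : ∀ d a q, ∃ d', σ d' = a * σ d * a⁻¹ ∧ ∀ p, e d' p = e d (q * p)

section
variable {A : Type} [Group A] (D : Dat A)

/-- The map on `G` underlying the twisted action. -/
def Dat.fn (d : A) (g : S3 × S3) : S3 × S3 :=
  (D.σ d, 1) * g * (D.e d (par g), D.e d (par g))

theorem Dat.par_fn (d : A) (g : S3 × S3) :
    par (D.fn d g) = Equiv.Perm.sign (D.σ d) * par g := by
  rw [Dat.fn, par_mul, par_mul]
  have : par (D.e d (par g), D.e d (par g)) = 1 := Int.units_mul_self _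
  rw [this, mul_one]
  simp [par]

theorem Dat.fn_one (g : S3 × S3) : D.fn 1 g = g := by
  simp only [Dat.fn, D.σ_one, D.e_one]
  ext <;> simp

theorem Dat.fn_mul (d d' : A) (g : S3 × S3) : D.fn (d * d') g = D.fn d (D.fn d' g) := by
  conv_rhs => rw [Dat.fn, D.par_fn]
  simp only [Dat.fn, D.σ_mul, D.e_mul]
  ext1 <;> simp [mul_assoc]

theorem par_of_mem (c₁ c₂ : S3) (h₁ : orderOf c₁ = 3) (h₂ : orderOf c₂ = 3)
    (h : S3 × S3) (hh : h ∈ Subgroup.zpowers (c₁, c₂)) : par h = 1 := by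
  rw [mem_H_iff c₁ c₂ h₁ h₂] at hh
  rcases order_three_cases c₁ h₁ with rfl | rfl <;> rcases order_three_cases c₂ h₂ with rfl | rfl <;>
  rcases hh with rfl | rfl | rfl <;> decide

theorem conj_tau_mem (c₁ c₂ : S3) (h₁ : orderOf c₁ = 3) (h₂ : orderOf c₂ = 3)
    (h : S3 × S3) (hh : h ∈ Subgroup.zpowers (c₁, c₂)) (t : S3) (ht : t = 1 ∨ t = tau) :
    (t, t)⁻¹ * h * (t, t) ∈ Subgroup.zpowers (c₁, c₂) := by
  rw [mem_H_iff c₁ c₂ h₁ h₂] at hh ⊢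
  rcases order_three_cases c₁ h₁ with rfl | rfl <;> rcases order_three_cases c₂ h₂ with rfl | rfl <;>
  rcases ht with rfl | rfl <;> rcases hh with rfl | rfl | rfl <;> decide

theorem free_aux (c₁ c₂ : S3) (h₁ : orderOf c₁ = 3) (h₂ : orderOf c₂ = 3)
    (s t : S3) (ht : t = 1 ∨ t = tau) (hh : (s, 1) * (t, t) ∈ Subgroup.zpowers (c₁, c₂)) :
    s = 1 ∧ t = 1 := by
  rw [mem_H_iff c₁ c₂ h₁ h₂] at hh
  revert s
  rcases order_three_cases c₁ h₁ with rfl | rfl <;> rcases order_three_cases c₂ h₂ with rfl | rfl <;>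
  rcases ht with rfl | rfl <;> decide

variable (c₁ c₂ : S3) (h₁ : orderOf c₁ = 3) (h₂ : orderOf c₂ = 3)

/-- The twisted action on cosets. -/
def Dat.act (d : A) :
    (S3 × S3) ⧸ Subgroup.zpowers (c₁, c₂) → (S3 × S3) ⧸ Subgroup.zpowers (c₁, c₂) :=
  Quotient.map' (D.fn d) (by
    intro g g' hg
    rw [QuotientGroup.leftRel_apply] at hg ⊢
    obtain ⟨h, rfl⟩ : ∃ h, g' = g * h := ⟨g⁻¹ * g', by group⟩
    rw [inv_mul_cancel_left] at hg
    have hp : par (g * h) = par g := by rw [par_mul, par_of_mem c₁ c₂ h₁ h₂ h hg, mul_one]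
    have := conj_tau_mem c₁ c₂ h₁ h₂ h hg _ (D.e_val d (par g))
    simp only [Dat.fn, hp]
    convert this using 1
    group)

theorem Dat.act_mk (d : A) (g : S3 × S3) :
    D.act c₁ c₂ h₁ h₂ d (QuotientGroup.mk g) = QuotientGroup.mk (D.fn d g) := rfl

/-- The permutation representation attached to the twisted action. -/
def Dat.hom : A →* Equiv.Perm ((S3 × S3) ⧸ Subgroup.zpowers (c₁, c₂)) :=
  MonoidHom.toHomPerm
    { toFun := D.act c₁ c₂ h₁ h₂
      map_one' := by
        funext x
        induction x using QuotientGroup.induction_on with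
        | H g => rw [Dat.act_mk, D.fn_one]; rfl
      map_mul' := by
        intro d d'
        funext x
        induction x using QuotientGroup.induction_on with
        | H g =>
          rw [Dat.act_mk, D.fn_mul]; rfl }

theorem Dat.hom_mk (d : A) (g : S3 × S3) :
    D.hom c₁ c₂ h₁ h₂ d (QuotientGroup.mk g) = QuotientGroup.mk (D.fn d g) := rfl

theorem Dat.hom_free (d : A) (x : (S3 × S3) ⧸ Subgroup.zpowers (c₁, c₂))
    (hx : D.hom c₁ c₂ h₁ h₂ d x = x) : d = 1 := by
  induction x using QuotientGroup.induction_on with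
  | H g =>
    rw [Dat.hom_mk, eq_comm, QuotientGroup.eq] at hx
    have hx' : ((g.1⁻¹ * D.σ d * g.1, 1) : S3 × S3) * (D.e d (par g), D.e d (par g)) ∈
        Subgroup.zpowers (c₁, c₂) := by
      convert hx using 1
      simp only [Dat.fn]
      ext1 <;> simp [mul_assoc]
    obtain ⟨hs, ht⟩ := free_aux c₁ c₂ h₁ h₂ _ _ (D.e_val d _) hx'
    refine D.free d _ ?_ ht
    rw [mul_assoc, inv_mul_eq_one] at hs
    exact mul_eq_right.1 hs.symm

theorem card_quot (c₁ c₂ : S3) (h₁ : orderOf c₁ = 3) (h₂ : orderOf c₂ = 3) :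
    Nat.card (Subgroup.zpowers (c₁, c₂)) = 3 ∧
    Nat.card ((S3 × S3) ⧸ Subgroup.zpowers (c₁, c₂)) = 12 := by
  have h3 : Nat.card (Subgroup.zpowers (c₁, c₂)) = 3 := by
    rw [Nat.card_zpowers, Prod.orderOf_mk, h₁, h₂]; rfl
  refine ⟨h3, ?_⟩
  have hG : Nat.card (S3 × S3) = 36 := by
    rw [Nat.card_eq_fintype_card]; decide
  have := Subgroup.card_eq_card_quotient_mul_card_subgroup (Subgroup.zpowers (c₁, c₂))
  rw [hG, h3] at this
  omega

theorem Dat.main {A : Type} [Group A] (D : Dat A) (c₁ c₂ : S3) (h₁ : orderOf c₁ = 3)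
    (h₂ : orderOf c₂ = 3) (hA : Nat.card A = 12) :
    ∃ N : Subgroup (Equiv.Perm ((S3 × S3) ⧸ Subgroup.zpowers (c₁, c₂))),
      IsRegularSubgroup N ∧
      (MulAction.toPermHom (S3 × S3) ((S3 × S3) ⧸ Subgroup.zpowers (c₁, c₂))).range ≤
        Subgroup.normalizer
          (N : Set (Equiv.Perm ((S3 × S3) ⧸ Subgroup.zpowers (c₁, c₂)))) ∧
      Nonempty (N ≃* A) := by
  have hfree := D.hom_free c₁ c₂ h₁ h₂
  set f := D.hom c₁ c₂ h₁ h₂ with hf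
  have hinj : Function.Injective f := by
    rw [injective_iff_map_eq_one]
    intro d hd
    exact hfree d (QuotientGroup.mk 1) (by rw [hd]; rfl)
  have hquot := (card_quot c₁ c₂ h₁ h₂).2
  have hnorm : ∀ (g : S3 × S3) (d : A), ∃ d', ∀ x : (S3 × S3) ⧸ Subgroup.zpowers (c₁, c₂),
      g • (f d (g⁻¹ • x)) = f d' x := by
    intro g d
    obtain ⟨d', hs, he⟩ := D.conj d g.1 (par g⁻¹)
    refine ⟨d', fun x => ?_⟩
    induction x using QuotientGroup.induction_on with
    | H k =>
      have e1 : g⁻¹ • (QuotientGroup.mk k : (S3 × S3) ⧸ Subgroup.zpowers (c₁, c₂)) =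
        QuotientGroup.mk (g⁻¹ * k) := rfl
      rw [e1, hf, Dat.hom_mk, Dat.hom_mk]
      have e2 : ∀ y : S3 × S3,
        g • (QuotientGroup.mk y : (S3 × S3) ⧸ Subgroup.zpowers (c₁, c₂)) =
        QuotientGroup.mk (g * y) := fun _ => rfl
      rw [e2]
      congr 1
      simp only [Dat.fn, hs, he, par_mul]
      ext1 <;> simp [mul_assoc]
  refine ⟨f.range, ⟨?_, ?_⟩, ?_, ⟨(MonoidHom.ofInjective hinj).symm⟩⟩
  · intro x y
    have : Finite A := Nat.finite_of_card_ne_zero (by omega)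
    have : Finite ((S3 × S3) ⧸ Subgroup.zpowers (c₁, c₂)) :=
      Nat.finite_of_card_ne_zero (by omega)
    have hb : Function.Bijective (fun d : A => f d x) := by
      rw [Nat.bijective_iff_injective_and_card]
      refine ⟨?_, by rw [hA, hquot]⟩
      intro d d' hd
      have : f (d'⁻¹ * d) x = x := by
        rw [map_mul, Equiv.Perm.mul_apply]
        simp only at hd
        rw [hd, ← Equiv.Perm.mul_apply, ← map_mul, inv_mul_cancel, map_one]; rfl
      have := hfree _ _ this
      exact (inv_mul_eq_one.1 this).symm
    obtain ⟨d, hd⟩ := hb.2 y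
    exact ⟨f d, ⟨d, rfl⟩, hd⟩
  · rintro _ ⟨d, rfl⟩ x hx
    rw [hfree d x hx, map_one]
  · rintro _ ⟨g, rfl⟩
    have hle : ∀ (g : S3 × S3) (n), n ∈ f.range →
        MulAction.toPermHom (S3 × S3) ((S3 × S3) ⧸ Subgroup.zpowers (c₁, c₂)) g * n *
        (MulAction.toPermHom (S3 × S3) ((S3 × S3) ⧸ Subgroup.zpowers (c₁, c₂)) g)⁻¹ ∈ f.range := by
      rintro g _ ⟨d, rfl⟩
      obtain ⟨d', hd'⟩ := hnorm g d
      refine ⟨d', ?_⟩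
      ext1 x
      rw [← map_inv]
      exact (hd' x).symm
    rw [Subgroup.mem_normalizer_iff]
    intro n
    refine ⟨hle g n, fun hn => ?_⟩
    have := hle g⁻¹ _ hn
    rw [map_inv] at this
    convert this using 1
    group

end

/-- `τ` if the argument is odd, else `1`. -/
def tauPow (k : ℕ) : S3 := if k % 2 = 1 then tau else 1

/-- The map from the dihedral group to `S₃`. -/
def sigD : DihedralGroup 6 → S3
  | .r i => rot ^ i.val
  | .sr i => tau * rot ^ i.val

/-- The right-translation part for the dihedral group. -/
def epsD : DihedralGroup 6 → ℤˣ → S3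
  | .r i, _ => tauPow i.val
  | .sr i, _ => tauPow i.val

/-- The map from the dicyclic group to `S₃`. -/
def sigQ : QuaternionGroup 3 → S3
  | .a i => rot ^ (ZMod.val (n := 6) i)
  | .xa i => tau * rot ^ (ZMod.val (n := 6) i)

/-- The right-translation part for the dicyclic group. -/
def epsQ : QuaternionGroup 3 → ℤˣ → S3
  | .a i, _ => tauPow (ZMod.val (n := 6) i)
  | .xa i, p => tauPow (ZMod.val (n := 6) i + if p = -1 then 1 else 0)

set_option maxRecDepth 100000 in
set_option maxHeartbeats 4000000 in
/-- The data for the dihedral group. -/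
def datD : Dat (DihedralGroup 6) where
  σ := sigD
  e := epsD
  σ_one := by decide
  σ_mul := by decide
  e_val := by decide
  e_one := by decide
  e_mul := by decide
  free := by decide
  conj := by decide

set_option maxRecDepth 100000 in
set_option maxHeartbeats 4000000 in
/-- The data for the dicyclic group. -/
def datQ : Dat (QuaternionGroup 3) where
  σ := sigQ
  e := epsQ
  σ_one := by decide
  σ_mul := by decide
  e_val := by decide
  e_one := by decide
  e_mul := by decide
  free := by decide
  conj := by decide

theorem core_aux (c₁ c₂ : S3) (h₁ : orderOf c₁ = 3) (h₂ : orderOf c₂ = 3)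
    (h : S3 × S3) (hh : h ∈ Subgroup.zpowers (c₁, c₂))
    (hc : (tau, 1) * h * (tau, 1)⁻¹ ∈ Subgroup.zpowers (c₁, c₂)) : h = 1 := by
  rw [mem_H_iff c₁ c₂ h₁ h₂] at hh hc
  revert hc
  rcases order_three_cases c₁ h₁ with rfl | rfl <;> rcases order_three_cases c₂ h₂ with rfl | rfl <;>
  rcases hh with rfl | rfl | rfl <;> decide

/-- Let `G = S₃ × S₃` and `H = ⟨(c₁, c₂)⟩` with `c₁, c₂` of order 3, so that `H` has
order 3 and is core-free. Then (a) `H` has no normal complement in `G` (indeed `G` has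
no normal subgroup of order 12), and (b) `Sym(G⧸H)` contains regular subgroups
normalized by the left-translation image of `G`, one isomorphic to the dihedral group of
order 12 and one isomorphic to the dicyclic group of order 12. -/
theorem S3_prod_S3_mod_diagonal_C3
    (c₁ c₂ : Equiv.Perm (Fin 3)) (h₁ : orderOf c₁ = 3) (h₂ : orderOf c₂ = 3)
    (H : Subgroup (Equiv.Perm (Fin 3) × Equiv.Perm (Fin 3)))
    (hH : H = Subgroup.zpowers (c₁, c₂)) :
    Nat.card H = 3 ∧
    (∀ K : Subgroup (Equiv.Perm (Fin 3) × Equiv.Perm (Fin 3)), K.Normal → K ≤ H → K = ⊥) ∧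
    (¬ ∃ N : Subgroup (Equiv.Perm (Fin 3) × Equiv.Perm (Fin 3)), IsNormalComplement N H) ∧
    (∀ K : Subgroup (Equiv.Perm (Fin 3) × Equiv.Perm (Fin 3)), K.Normal →
      Nat.card K ≠ 12) ∧
    (∃ N₁ N₂ : Subgroup (Equiv.Perm ((Equiv.Perm (Fin 3) × Equiv.Perm (Fin 3)) ⧸ H)),
      IsRegularSubgroup N₁ ∧
      (MulAction.toPermHom (Equiv.Perm (Fin 3) × Equiv.Perm (Fin 3))
        ((Equiv.Perm (Fin 3) × Equiv.Perm (Fin 3)) ⧸ H)).range ≤ Subgroup.normalizer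
          (N₁ : Set (Equiv.Perm ((Equiv.Perm (Fin 3) × Equiv.Perm (Fin 3)) ⧸ H))) ∧
      Nonempty (N₁ ≃* DihedralGroup 6) ∧
      IsRegularSubgroup N₂ ∧
      (MulAction.toPermHom (Equiv.Perm (Fin 3) × Equiv.Perm (Fin 3))
        ((Equiv.Perm (Fin 3) × Equiv.Perm (Fin 3)) ⧸ H)).range ≤ Subgroup.normalizer
          (N₂ : Set (Equiv.Perm ((Equiv.Perm (Fin 3) × Equiv.Perm (Fin 3)) ⧸ H))) ∧
      Nonempty (N₂ ≃* QuaternionGroup 3)) := by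
  subst hH
  obtain ⟨hc3, hc12⟩ := card_quot c₁ c₂ h₁ h₂
  refine ⟨hc3, ?_, ?_, no_normal_twelve, ?_⟩
  · intro K hK hle
    rw [eq_bot_iff]
    intro k hk
    exact core_aux c₁ c₂ h₁ h₂ k (hle hk) (hle (hK.conj_mem k hk (tau, 1)))
  · rintro ⟨N, hN, hd, hu⟩
    apply no_normal_twelve N hN
    have hcomp := Subgroup.isComplement'_of_disjoint_and_mul_eq_univ (disjoint_iff.2 hd) hu
    have := hcomp.card_mul_card
    have hG : Nat.card (S3 × S3) = 36 := by
      rw [Nat.card_eq_fintype_card]; decide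
    rw [hc3, hG] at this
    exact Nat.eq_of_mul_eq_mul_right (by norm_num : 0 < 3) this
  · obtain ⟨N₁, r₁, n₁, i₁⟩ := datD.main c₁ c₂ h₁ h₂ (by rw [DihedralGroup.nat_card])
    obtain ⟨N₂, r₂, n₂, i₂⟩ := datQ.main c₁ c₂ h₁ h₂
      (by rw [Nat.card_eq_fintype_card, QuaternionGroup.card])
    exact ⟨N₁, N₂, r₁, n₁, i₁, r₂, n₂, i₂⟩
end

section
/- Every finite group of order 60 that is not isomorphic to the alternating group A_5 has a solvable holomorph; equivalently, every group of order 60 other than A_5 is solvable and has solvable automorphism group. -/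
namespace Sixty

theorem solvable_of_ker {G H : Type*} [Group G] [Group H] (f : G →* H)
    (hk : Group.IsSolvable f.ker) (hH : Group.IsSolvable H) : Group.IsSolvable G :=
  Group.isSolvable_of_ker_le_range f.ker.subtype f (by simp)

theorem solvable_of_mulAut {G : Type*} [Group G] (h : Group.IsSolvable (MulAut G)) : Group.IsSolvable G := by
  refine solvable_of_ker (MulAut.conj : G →* MulAut G) ?_ h
  apply Group.isSolvable_of_comm
  rintro ⟨a, ha⟩ ⟨b, hb⟩
  have := DFunLike.congr_fun (MonoidHom.mem_ker.1 ha) b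
  simp only [MulAut.conj_apply, MulAut.one_apply] at this
  ext
  simpa using mul_inv_eq_iff_eq_mul.1 this

theorem mulAut_char {G : Type*} [Group G] (P : Subgroup G) [P.Characteristic]
    (hc : ∀ a ∈ P, ∀ b ∈ P, a * b = b * a)
    (h1 : Group.IsSolvable (MulAut P)) (h2 : Group.IsSolvable (MulAut (G ⧸ P))) :
    Group.IsSolvable (MulAut G) := by
  have hP : ∀ (φ : MulAut G), P.map (φ : G →* G) = P := fun φ =>
    Subgroup.characteristic_iff_map_eq.1 inferInstance φ
  let q : MulAut G →* MulAut (G ⧸ P) := MonoidHom.mk'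
    (fun φ => QuotientGroup.congr P P φ (hP φ)) (by
      intro a b
      ext x
      induction x using QuotientGroup.induction_on
      rfl)
  refine solvable_of_ker ((MulAut.characteristic P).prod q) ?_ inferInstance
  have key : ∀ φ ∈ ((MulAut.characteristic P).prod q).ker,
      (∀ x ∈ P, φ x = x) ∧ ∀ x, x⁻¹ * φ x ∈ P := by
    intro φ hφ
    rw [MonoidHom.mem_ker, MonoidHom.prod_apply, Prod.mk_eq_one] at hφ
    refine ⟨fun x hx => ?_, fun x => ?_⟩
    · exact congrArg Subtype.val (DFunLike.congr_fun hφ.1 (⟨x, hx⟩ : P))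
    · have := DFunLike.congr_fun hφ.2 (x : G ⧸ P)
      exact QuotientGroup.eq.1 this.symm
  apply Group.isSolvable_of_comm
  rintro ⟨a, ha⟩ ⟨b, hb⟩
  obtain ⟨a1, a2⟩ := key a ha
  obtain ⟨b1, b2⟩ := key b hb
  ext x
  have e1 : a (b x) = a x * (x⁻¹ * b x) := by
    conv_lhs => rw [show b x = x * (x⁻¹ * b x) by group, map_mul, a1 _ (b2 x)]
  have e2 : b (a x) = b x * (x⁻¹ * a x) := by
    conv_lhs => rw [show a x = x * (x⁻¹ * a x) by group, map_mul, b1 _ (a2 x)]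
  change a (b x) = b (a x)
  have := hc _ (a2 x) _ (b2 x)
  rw [e1, e2]
  have := congrArg (x * ·) this
  simpa [mul_assoc] using this

theorem solvable_perm4 : Group.IsSolvable (Equiv.Perm (Fin 4)) := by
  refine solvable_of_ker (Equiv.Perm.sign : Equiv.Perm (Fin 4) →* ℤˣ) ?_ inferInstance
  change Group.IsSolvable (alternatingGroup (Fin 4))
  have h4 : Nat.card (Fin 4) = 4 := by simp
  have := alternatingGroup.normal_kleinFour h4
  rw [Group.isSolvable_iff_subgroup_quotient (alternatingGroup.kleinFour (Fin 4))]
  have hk := alternatingGroup.kleinFour_card_of_card_eq_four h4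
  constructor
  · have := IsPGroup.isMulCommutative_of_card_eq_prime_sq (p := 2) (hG := hk)
    exact Group.isSolvable_of_comm this.is_comm.comm
  · have h3 : Nat.card (alternatingGroup (Fin 4) ⧸ alternatingGroup.kleinFour (Fin 4)) = 3 := by
      have := Subgroup.card_eq_card_quotient_mul_card_subgroup (alternatingGroup.kleinFour (Fin 4))
      rw [hk, alternatingGroup.card_of_card_eq_four h4] at this
      omega
    have := isCyclic_of_prime_card (p := 3) h3
    exact Group.isSolvable_of_comm (fun a b => (IsCyclic.commGroup (α := _)).mul_comm a b)

theorem mulAut_le4 {G : Type*} [Group G] [Finite G] (h : Nat.card G ≤ 4) :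
    Group.IsSolvable (MulAut G) := by
  obtain ⟨n, ⟨e⟩⟩ := Finite.exists_equiv_fin G
  have hn : n ≤ 4 := by simpa [Nat.card_congr e] using h
  let i : G ↪ Fin 4 := e.toEmbedding.trans (Fin.castLEEmb hn)
  have := solvable_perm4
  have h2 : Function.Injective (MulAut.toPerm G) := fun a b h => by
    ext x; exact DFunLike.congr_fun h x
  classical
  let := Fintype.ofFinite G
  exact Group.isSolvable_of_isSolvable_injective
    (f := (Equiv.Perm.viaEmbeddingHom i).comp (MulAut.toPerm G))
    ((Equiv.Perm.viaEmbeddingHom_injective i).comp h2)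

theorem mulAut_prime {G : Type*} [Group G] [Finite G] {p : ℕ} [Fact p.Prime]
    (h : Nat.card G = p) : Group.IsSolvable (MulAut G) := by
  have := isCyclic_of_prime_card h
  exact Group.isSolvable_of_isSolvable_injective (f := (IsCyclic.mulAutMulEquiv G).toMonoidHom)
    (IsCyclic.mulAutMulEquiv G).injective

theorem solvable_hol {N : Type*} [Group N] (h : Group.IsSolvable (MulAut N)) :
    Group.IsSolvable (Subgroup.normalizer
      ((MulAction.toPermHom N N).range : Set (Equiv.Perm N))) := by
  have hN := solvable_of_mulAut h
  have hinj : Function.Injective (MulAction.toPermHom N N) := MulAction.toPerm_injective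
  let e := MonoidHom.ofInjective hinj
  refine solvable_of_ker (Subgroup.normalizerMonoidHom _) ?_ ?_
  · have key : ∀ f : (Subgroup.normalizerMonoidHom (MulAction.toPermHom N N).range).ker,
        ∀ x, (f : Equiv.Perm N) x = x * (f : Equiv.Perm N) 1 := by
      rintro ⟨f, hf⟩ x
      rw [Subgroup.normalizerMonoidHom_ker, Subgroup.mem_subgroupOf,
        Subgroup.mem_centralizer_iff] at hf
      have := hf (MulAction.toPermHom N N x) ⟨x, rfl⟩
      have := DFunLike.congr_fun this 1
      simpa using this.symm
    let r : (Subgroup.normalizerMonoidHom (MulAction.toPermHom N N).range).ker →* N :=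
      MonoidHom.mk' (fun f => ((f : Equiv.Perm N) 1)⁻¹) (by
        intro a b
        have := key a ((b : Equiv.Perm N) 1)
        rw [← mul_inv_rev, ← this]
        rfl)
    refine Group.isSolvable_of_isSolvable_injective (f := r) ?_
    intro a b hab
    have h1 : (a : Equiv.Perm N) 1 = (b : Equiv.Perm N) 1 := inv_injective hab
    ext x
    rw [key a x, key b x, h1]
  · exact Group.isSolvable_of_isSolvable_injective (f := (MulAut.congr e).symm.toMonoidHom)
      (MulAut.congr e).symm.injective


/-- Nontrivial elements of the Sylow `p`-subgroups. -/
def sylSet (p : ℕ) (G : Type*) [Group G] : Set G := {g | g ≠ 1 ∧ ∃ P : Sylow p G, g ∈ P}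

theorem ncard_sylSet {G : Type*} [Group G] [Finite G] {p k : ℕ}
    (hk : ∀ P : Sylow p G, Nat.card P = k)
    (hd : ∀ P Q : Sylow p G, P ≠ Q → ∀ x ∈ P, x ∈ Q → x = 1) :
    (sylSet p G).ncard = Nat.card (Sylow p G) * (k - 1) := by
  classical
  let := Fintype.ofFinite (Sylow p G)
  let f : (Σ P : Sylow p G, {x : P // x ≠ 1}) → sylSet p G :=
    fun z => ⟨z.2.1.1, fun h => z.2.2 (Subtype.ext h), z.1, z.2.1.2⟩
  have hf : Function.Bijective f := by
    constructor
    · rintro ⟨P, ⟨x, hx⟩, hx1⟩ ⟨Q, ⟨y, hy⟩, hy1⟩ h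
      have hxy : x = y := congrArg Subtype.val h
      subst hxy
      have : P = Q := by
        by_contra hPQ
        exact hx1 (Subtype.ext (hd P Q hPQ x hx hy))
      subst this
      rfl
    · rintro ⟨x, hx, P, hP⟩
      exact ⟨⟨P, ⟨x, hP⟩, fun h => hx (congrArg Subtype.val h)⟩, rfl⟩
  rw [← Nat.card_coe_set_eq, ← Nat.card_congr (Equiv.ofBijective f hf), Nat.card_sigma]
  have : ∀ P : Sylow p G, Nat.card {x : P // x ≠ 1} = k - 1 := by
    intro P
    have h := Set.ncard_add_ncard_compl ({1} : Set P)
    rw [Set.ncard_singleton, hk P] at h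
    have : Nat.card {x : P // x ≠ 1} = ({1}ᶜ : Set P).ncard := Nat.card_coe_set_eq _
    omega
  simp [this]

theorem sylow_card {G : Type*} [Group G] [Finite G] {p n m : ℕ} [hp : Fact p.Prime]
    (h : Nat.card G = p ^ n * m) (hm : ¬ p ∣ m) (P : Sylow p G) : Nat.card P = p ^ n := by
  have hm0 : m ≠ 0 := by rintro rfl; exact hm (dvd_zero _)
  rw [P.card_eq_multiplicity, h, Nat.factorization_mul (pow_ne_zero _ hp.out.ne_zero) hm0]
  simp [Nat.factorization_eq_zero_of_not_dvd hm, hp.out.factorization_self]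

theorem sylow_num {G : Type*} [Group G] [Finite G] {p n m : ℕ} [hp : Fact p.Prime]
    (h : Nat.card G = p ^ n * m) (hm : ¬ p ∣ m) :
    Nat.card (Sylow p G) ∣ m ∧ Nat.card (Sylow p G) % p = 1 := by
  obtain ⟨P⟩ : Nonempty (Sylow p G) := inferInstance
  constructor
  · have h1 := P.card_dvd_index
    have h2 := Subgroup.card_mul_index (P : Subgroup G)
    rw [show Nat.card (P : Subgroup G) = p ^ n from sylow_card h hm P, h] at h2
    rwa [Nat.eq_of_mul_eq_mul_left (pow_pos hp.out.pos n) h2] at h1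
  · have := card_sylow_modEq_one p G
    rwa [Nat.ModEq, Nat.mod_eq_of_lt hp.out.one_lt] at this

theorem disj_prime {G : Type*} [Group G] [Finite G] {p : ℕ} [hp : Fact p.Prime]
    (hk : ∀ P : Sylow p G, Nat.card P = p) :
    ∀ P Q : Sylow p G, P ≠ Q → ∀ x ∈ P, x ∈ Q → x = 1 := by
  intro P Q hPQ x hxP hxQ
  by_contra hx
  have key : ∀ R : Sylow p G, x ∈ R → Subgroup.zpowers x = R := by
    intro R hR
    have hle : Subgroup.zpowers x ≤ R := Subgroup.zpowers_le.2 hR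
    apply Subgroup.eq_of_le_of_card_ge hle
    rw [Nat.card_zpowers, hk R]
    have hd : orderOf x ∣ p := by
      rw [← hk R]; exact Subgroup.orderOf_dvd_natCard _ hR
    rcases (Nat.dvd_prime hp.out).1 hd with h | h
    · exact absurd (orderOf_eq_one_iff.1 h) hx
    · exact h.ge
  exact hPQ (Sylow.ext ((key P hxP).symm.trans (key Q hxQ)))

theorem disj_coprime {G : Type*} [Group G] [Finite G] (P Q : Subgroup G)
    (h : (Nat.card P).Coprime (Nat.card Q)) (x : G) (hP : x ∈ P) (hQ : x ∈ Q) : x = 1 := by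
  rw [← orderOf_eq_one_iff]
  exact Nat.eq_one_of_dvd_coprimes h (Subgroup.orderOf_dvd_natCard _ hP)
    (Subgroup.orderOf_dvd_natCard _ hQ)

theorem sylow_char {G : Type*} [Group G] [Finite G] {p : ℕ} (h : Nat.card (Sylow p G) = 1)
    (P : Sylow p G) : (P : Subgroup G).Characteristic := by
  have := (Nat.card_eq_one_iff_unique.1 h).1
  infer_instance

theorem twelve {G : Type*} [Group G] [Finite G] (h : Nat.card G = 12) :
    ∃ K : Subgroup G, K.Characteristic ∧ (Nat.card K = 3 ∨ Nat.card K = 4) := by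
  have : Fact (Nat.Prime 3) := ⟨by norm_num⟩
  have h3 : Nat.card G = 3 ^ 1 * 4 := by simpa using h
  have h2 : Nat.card G = 2 ^ 2 * 3 := by simpa using h
  have c3 := fun P => sylow_card h3 (by norm_num) P
  have c2 := fun P => sylow_card h2 (by norm_num) P
  obtain ⟨d3, m3⟩ := sylow_num h3 (by norm_num)
  obtain ⟨P⟩ : Nonempty (Sylow 3 G) := inferInstance
  by_cases hn : Nat.card (Sylow 3 G) = 1
  · exact ⟨P, sylow_char hn P, Or.inl (by simpa using c3 P)⟩
  have hn4 : Nat.card (Sylow 3 G) = 4 := by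
    have hle := Nat.le_of_dvd (by norm_num) d3
    interval_cases Nat.card (Sylow 3 G) <;> simp_all
  have hS := ncard_sylSet (p := 3) (k := 3) (by simpa using c3) (disj_prime (by simpa using c3))
  rw [hn4] at hS
  have key : ∀ Q : Sylow 2 G, (Q : Set G) = (sylSet 3 G)ᶜ := by
    intro Q
    apply Set.eq_of_subset_of_ncard_le
    · rintro x hx ⟨hx1, R, hR⟩
      refine hx1 (disj_coprime R Q ?_ x hR hx)
      change Nat.Coprime (Nat.card R) (Nat.card Q)
      rw [c3 R, c2 Q]
      norm_num
    · have h1 := Set.ncard_add_ncard_compl (sylSet 3 G)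
      have h2 : (Q : Set G).ncard = 4 := c2 Q
      omega
    · exact Set.toFinite _
  obtain ⟨Q⟩ : Nonempty (Sylow 2 G) := inferInstance
  have : Subsingleton (Sylow 2 G) := ⟨fun A B => SetLike.coe_injective ((key A).trans (key B).symm)⟩
  exact ⟨Q, inferInstance, Or.inr (c2 Q)⟩

theorem mem_of_pow {G : Type*} [Group G] [Finite G] (K : Subgroup G) [K.Normal] {n : ℕ}
    (hn : K.index.Coprime n) (x : G) (hx : x ^ n = 1) : x ∈ K := by
  rw [← QuotientGroup.eq_one_iff, ← orderOf_eq_one_iff]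
  refine Nat.eq_one_of_dvd_coprimes hn ?_ ?_
  · exact orderOf_dvd_natCard _
  · apply orderOf_dvd_of_pow_eq_one
    rw [← QuotientGroup.mk_pow, hx, QuotientGroup.mk_one]

theorem thirty {G : Type*} [Group G] [Finite G] (h : Nat.card G = 30) :
    ∃ K : Subgroup G, K.Normal ∧ Nat.card K = 15 := by
  have h2 : Nat.card G = 2 ^ 1 * 15 := by simpa using h
  obtain ⟨P⟩ : Nonempty (Sylow 2 G) := inferInstance
  have c2 := sylow_card h2 (by norm_num) P
  have hP : IsCyclic P := isCyclic_of_prime_card (p := 2) (by simpa using c2)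
  have hc := IsCyclic.isComplement' (p := 2) (by rw [h]; norm_num) hP
  refine ⟨_, MonoidHom.normal_ker (MonoidHom.transferSylow P (hP.normalizer_le_centralizer
    (by rw [h]; norm_num))), ?_⟩
  · have := hc.card_mul_card
    rw [show Nat.card (P : Subgroup G) = 2 from by simpa using c2] at this
    have h15 := this.trans h
    omega

/-- the data of a group of order 60 with six Sylow 5-subgroups -/
structure Six (G : Type*) [Group G] : Prop where
  card : Nat.card G = 60
  num : Nat.card (Sylow 5 G) = 6

section
variable {G : Type*} [Group G] [Finite G]

theorem Six.c5 (h : Six G) (P : Sylow 5 G) : Nat.card P = 5 := by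
  have : Fact (Nat.Prime 5) := ⟨by norm_num⟩
  simpa using sylow_card (p := 5) (n := 1) (m := 12) (by simpa using h.card) (by norm_num) P

theorem Six.ncard (h : Six G) : (sylSet 5 G).ncard = 24 := by
  have : Fact (Nat.Prime 5) := ⟨by norm_num⟩
  rw [ncard_sylSet h.c5 (disj_prime h.c5), h.num]

theorem Six.pow (h : Six G) {x : G} (hx : x ∈ sylSet 5 G) : x ^ 5 = 1 := by
  obtain ⟨-, P, hP⟩ := hx
  have := Subgroup.orderOf_dvd_natCard (P : Subgroup G) hP
  rw [show Nat.card (P : Subgroup G) = 5 from h.c5 P] at this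
  exact orderOf_dvd_iff_pow_eq_one.1 this

theorem Six.le (h : Six G) (K : Subgroup G) (hK : sylSet 5 G ⊆ K) : 25 ≤ Nat.card K := by
  have h1 : insert 1 (sylSet 5 G) ⊆ (K : Set G) := Set.insert_subset K.one_mem hK
  have h2 := Set.ncard_le_ncard h1
  rw [Set.ncard_insert_of_notMem (fun h => h.1 rfl), h.ncard] at h2
  exact h2

theorem Six.sub (h : Six G) (K : Subgroup G) [K.Normal] (hK : 5 ∣ Nat.card K) :
    sylSet 5 G ⊆ K := by
  intro x hx
  refine mem_of_pow K (n := 5) ?_ x (h.pow hx)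
  have := Subgroup.card_mul_index K
  rw [h.card] at this
  obtain ⟨c, hc⟩ := hK
  rw [Nat.coprime_comm, Nat.Prime.coprime_iff_not_dvd (by norm_num)]
  rintro ⟨d, hd⟩
  rw [hc, hd] at this
  have : 5 * (c * d) = 12 := by nlinarith
  omega

theorem Six.not30 (h : Six G) (K : Subgroup G) [K.Normal] : Nat.card K ≠ 30 := by
  intro hK
  obtain ⟨M, hM, hM15⟩ := thirty hK
  have hs := h.sub K (by rw [hK]; norm_num)
  have hi : M.index = 2 := by
    have := Subgroup.card_mul_index M
    rw [hM15, hK] at this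
    omega
  have := h.le (M.map K.subtype) (by
    intro x hx
    refine ⟨⟨x, hs hx⟩, ?_, rfl⟩
    exact mem_of_pow M (n := 5) (by rw [hi]; norm_num) _ (Subtype.ext (h.pow hx)))
  rw [Subgroup.card_map_of_injective K.subtype_injective, hM15] at this
  omega

theorem Six.not34 (h : Six G) (K : Subgroup G) [K.Normal] :
    ¬ (Nat.card K = 3 ∨ Nat.card K = 4) := by
  intro hK
  have : Fact (Nat.Prime 5) := ⟨by norm_num⟩
  obtain ⟨P⟩ : Nonempty (Sylow 5 G) := inferInstance
  have hcomm : ∀ x ∈ P, ∀ k ∈ K, x * k * x⁻¹ = k := by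
    intro x hx k hk
    have h5 : x ^ 5 = 1 := by
      rcases eq_or_ne x 1 with rfl | hx1
      · simp
      · exact h.pow ⟨hx1, P, hx⟩
    let f : G →* Equiv.Perm K := (MulAut.toPerm K).comp MulAut.conjNormal
    have hf : f x = 1 := by
      rw [← orderOf_eq_one_iff]
      refine Nat.eq_one_of_dvd_coprimes (a := 5) (b := Nat.card (Equiv.Perm K)) ?_ ?_ ?_
      · rw [Nat.card_perm]
        rcases hK with hK | hK <;> rw [hK] <;> decide
      · apply orderOf_dvd_of_pow_eq_one
        rw [← map_pow, h5, map_one]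
      · exact orderOf_dvd_natCard _
    exact congrArg Subtype.val (DFunLike.congr_fun hf ⟨k, hk⟩)
  have hle : K ≤ Subgroup.normalizer (P : Set G) := by
    intro k hk
    have hc : k ∈ Subgroup.centralizer (P : Set G) := by
      rw [Subgroup.mem_centralizer_iff]
      intro x hx
      exact mul_inv_eq_iff_eq_mul.1 (hcomm x hx k hk)
    exact Subgroup.centralizer_le_normalizer _ hc
  have hN : Nat.card (Subgroup.normalizer (P : Set G)) = 10 := by
    have h1 := Subgroup.card_mul_index (Subgroup.normalizer (P : Set G))
    have h2 := P.card_eq_index_normalizer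
    rw [h.num] at h2
    rw [show (Subgroup.normalizer (P : Set G)).index = 6 from h2.symm, h.card] at h1
    omega
  have := Subgroup.card_dvd_of_le hle
  rw [hN] at this
  rcases hK with hK | hK <;> rw [hK] at this <;> omega

theorem Six.simple (h : Six G) (K : Subgroup G) [hKn : K.Normal] : K = ⊥ ∨ K = ⊤ := by
  have hdvd : Nat.card K ∣ 60 := h.card ▸ Subgroup.card_subgroup_dvd_card K
  by_cases h5 : 5 ∣ Nat.card K
  · right
    have h25 := h.le K (h.sub K h5)
    have h30 := h.not30 K
    apply Subgroup.eq_top_of_card_eq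
    rw [h.card]
    obtain ⟨c, hc⟩ := hdvd
    have : c ≤ 2 := by nlinarith
    interval_cases c <;> omega
  · have hd12 : Nat.card K ∣ 12 := by
      refine Nat.Coprime.dvd_of_dvd_mul_right (n := 5) ?_ (show _ ∣ 12 * 5 from hdvd)
      exact ((Nat.Prime.coprime_iff_not_dvd (by norm_num)).2 h5).symm
    have h34 := h.not34 K
    have hmem : Nat.card K ∈ Nat.divisors 12 := by simpa using hd12
    rw [show Nat.divisors 12 = {1, 2, 3, 4, 6, 12} by decide] at hmem
    simp only [Finset.mem_insert, Finset.mem_singleton] at hmem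
    have hchar : ∀ M : Subgroup K, M.Characteristic → ¬ (Nat.card M = 3 ∨ Nat.card M = 4) := by
      intro M hM hc
      have : (M.map K.subtype).Normal := inferInstance
      apply h.not34 (M.map K.subtype)
      rwa [Subgroup.card_map_of_injective K.subtype_injective]
    rcases hmem with hk | hk | hk | hk | hk | hk
    · left
      exact Subgroup.card_eq_one.1 hk
    · exfalso
      have hq : Nat.card (G ⧸ K) = 30 := by
        have := Subgroup.card_eq_card_quotient_mul_card_subgroup K
        rw [h.card, hk] at this
        omega
      obtain ⟨M, hM, hM15⟩ := thirty hq
      apply h.not30 (M.comap (QuotientGroup.mk' K))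
      have h1 := Subgroup.card_mul_index (M.comap (QuotientGroup.mk' K))
      rw [Subgroup.index_comap_of_surjective _ (QuotientGroup.mk'_surjective K), h.card] at h1
      have h2 := Subgroup.card_mul_index M
      rw [hM15, hq] at h2
      have : M.index = 2 := by omega
      rw [this] at h1
      omega
    · exact absurd (Or.inl hk) h34
    · exact absurd (Or.inr hk) h34
    · exfalso
      have : Fact (Nat.Prime 3) := ⟨by norm_num⟩
      obtain ⟨d3, m3⟩ := sylow_num (G := K) (p := 3) (n := 1) (m := 2) (by simpa using hk)
        (by norm_num)
      obtain ⟨P⟩ : Nonempty (Sylow 3 K) := inferInstance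
      have c3 := sylow_card (G := K) (p := 3) (n := 1) (m := 2) (by simpa using hk)
        (by norm_num) P
      have hle := Nat.le_of_dvd (by norm_num) d3
      exact hchar P (sylow_char (by omega) P) (Or.inl (by simpa using c3))
    · exfalso
      obtain ⟨M, hM, hc⟩ := twelve hk
      exact hchar M hM hc

theorem Six.dvd_factorial (h : Six G) (H : Subgroup G) (hH : H ≠ ⊤) :
    Function.Injective (MulAction.toPermHom G (G ⧸ H)) := by
  rw [← MonoidHom.ker_eq_bot_iff, ← Subgroup.normalCore_eq_ker]
  rcases h.simple H.normalCore with h1 | h1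
  · exact h1
  · exact absurd (top_le_iff.1 (h1 ▸ H.normalCore_le)) hH

theorem Six.index_ne_three (h : Six G) (H : Subgroup G) : H.index ≠ 3 := by
  intro hi
  have hinj := h.dvd_factorial H (by rintro rfl; simp at hi)
  have := Nat.card_le_card_of_injective _ hinj
  rw [Nat.card_perm, h.card, show Nat.card (G ⧸ H) = 3 from hi] at this
  revert this
  decide

theorem Six.iso (h : Six G) (H : Subgroup G) (hi : H.index = 5) :
    Nonempty (G ≃* alternatingGroup (Fin 5)) := by
  have hinj := h.dvd_factorial H (by rintro rfl; simp at hi)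
  let e : (G ⧸ H) ≃ Fin 5 := Finite.equivFinOfCardEq hi
  let f : G →* Equiv.Perm (Fin 5) :=
    (e.permCongrHom : Equiv.Perm (G ⧸ H) →* Equiv.Perm (Fin 5)).comp
      (MulAction.toPermHom G (G ⧸ H))
  have hf : Function.Injective f := e.permCongrHom.injective.comp hinj
  have hr : f.range = alternatingGroup (Fin 5) := by
    apply Equiv.Perm.eq_alternatingGroup_of_index_eq_two
    have h1 := Subgroup.card_mul_index f.range
    rw [← Nat.card_congr (MonoidHom.ofInjective hf).toEquiv, h.card, Nat.card_perm, Nat.card_fin,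
      show Nat.factorial 5 = 120 from rfl] at h1
    omega
  exact ⟨(MonoidHom.ofInjective hf).trans (MulEquiv.subgroupCongr hr)⟩

theorem Six.exists_index (h : Six G) : ∃ H : Subgroup G, H.index = 5 := by
  have h60 : Nat.card G = 2 ^ 2 * 15 := by simpa using h.card
  have c2 : ∀ P : Sylow 2 G, Nat.card P = 4 := fun P => sylow_card h60 (by norm_num) P
  obtain ⟨d2, m2⟩ := sylow_num h60 (by norm_num)
  have hdiv : ∀ n, n ∣ 15 → n = 1 ∨ n = 3 ∨ n = 5 ∨ n = 15 := by
    intro n hn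
    have hmem : n ∈ Nat.divisors 15 := by simpa using hn
    rw [show Nat.divisors 15 = {1, 3, 5, 15} by decide] at hmem
    simpa using hmem
  have hnn : ∀ P : Sylow 2 G, ¬ (P : Subgroup G).Normal := by
    intro P hP
    have c : Nat.card (P : Subgroup G) = 4 := c2 P
    rcases h.simple (P : Subgroup G) with h1 | h1
    · rw [h1] at c; simp at c
    · rw [h1, Subgroup.card_top, h.card] at c; omega
  obtain ⟨P₀⟩ : Nonempty (Sylow 2 G) := inferInstance
  have hidx : (Subgroup.normalizer (P₀ : Set G)).index = Nat.card (Sylow 2 G) :=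
    P₀.card_eq_index_normalizer.symm
  rcases hdiv _ d2 with hn | hn | hn | hn
  · have := sylow_char hn P₀
    exact absurd (Subgroup.normal_of_characteristic _) (hnn P₀)
  · exact absurd (hidx.trans hn) (h.index_ne_three _)
  · exact ⟨_, hidx.trans hn⟩
  have hex : ∃ P Q : Sylow 2 G, P ≠ Q ∧ ∃ x ∈ P, x ∈ Q ∧ x ≠ 1 := by
    by_contra! hcon
    have hS := ncard_sylSet c2 hcon
    rw [hn] at hS
    have hdisj : Disjoint (sylSet 2 G) (sylSet 5 G) := by
      rw [Set.disjoint_left]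
      rintro x ⟨hx, P, hP⟩ ⟨-, Q, hQ⟩
      refine hx (disj_coprime P Q ?_ x hP hQ)
      change Nat.Coprime (Nat.card P) (Nat.card Q)
      rw [c2 P, h.c5 Q]
      norm_num
    have hU := Set.ncard_union_eq hdisj
    have := Set.ncard_le_card (sylSet 2 G ∪ sylSet 5 G)
    rw [hU, hS, h.ncard, h.card] at this
    omega
  obtain ⟨P, Q, hPQ, x, hxP, hxQ, hx1⟩ := hex
  have hle : ∀ R : Sylow 2 G, x ∈ R → (R : Subgroup G) ≤ Subgroup.centralizer {x} := by
    intro R hR y hy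
    have hc := IsPGroup.isMulCommutative_of_card_eq_prime_sq (p := 2) (hG := c2 R)
    rw [Subgroup.mem_centralizer_singleton_iff]
    have := hc.is_comm.comm (⟨y, hy⟩ : R) ⟨x, hR⟩
    exact congrArg Subtype.val this
  have hP := hle P hxP
  have hQ := hle Q hxQ
  have hcd : (Subgroup.centralizer {x}).index ∣ 15 := by
    have h1 := Subgroup.index_dvd_of_le hP
    have h2 := Subgroup.card_mul_index (P : Subgroup G)
    rw [show Nat.card (P : Subgroup G) = 4 from c2 P, h.card] at h2
    rwa [show (P : Subgroup G).index = 15 by omega] at h1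
  rcases hdiv _ hcd with hi | hi | hi | hi
  · exfalso
    have hxc : x ∈ Subgroup.center G := by
      rw [Subgroup.mem_center_iff]
      intro g
      have : g ∈ Subgroup.centralizer {x} := by
        rw [Subgroup.index_eq_one.1 hi]; trivial
      exact Subgroup.mem_centralizer_singleton_iff.1 this
    rcases h.simple (Subgroup.center G) with hz | hz
    · rw [hz, Subgroup.mem_bot] at hxc
      exact hx1 hxc
    · apply hnn P
      refine ⟨fun n hn g => ?_⟩
      have : n ∈ Subgroup.center G := by rw [hz]; trivial
      rw [Subgroup.mem_center_iff.1 this g]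
      simpa using hn
  · exact absurd hi (h.index_ne_three _)
  · exact ⟨_, hi⟩
  · exfalso
    have hcc : Nat.card (Subgroup.centralizer {x}) = 4 := by
      have h1 := Subgroup.card_mul_index (Subgroup.centralizer {x})
      rw [hi, h.card] at h1
      omega
    have key : ∀ R : Sylow 2 G, x ∈ R → (R : Subgroup G) = Subgroup.centralizer {x} := by
      intro R hR
      apply Subgroup.eq_of_le_of_card_ge (hle R hR)
      rw [hcc]
      exact (c2 R).ge
    exact hPQ (Sylow.ext ((key P hxP).trans (key Q hxQ).symm))

end

theorem mulAut_twelve {G : Type*} [Group G] [Finite G] (h : Nat.card G = 12) :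
    Group.IsSolvable (MulAut G) := by
  obtain ⟨K, hK, hc⟩ := twelve h
  have hq : Nat.card (G ⧸ K) ≤ 4 := by
    have := Subgroup.card_eq_card_quotient_mul_card_subgroup K
    rcases hc with hc | hc <;> rw [h, hc] at this <;> omega
  have hk : Nat.card K ≤ 4 := by omega
  refine mulAut_char K ?_ (mulAut_le4 hk) (mulAut_le4 hq)
  have hcomm : IsMulCommutative K := by
    rcases hc with hc | hc
    · have : Fact (Nat.Prime 3) := ⟨by norm_num⟩
      have := isCyclic_of_prime_card hc
      exact ⟨⟨(IsCyclic.commGroup (α := K)).mul_comm⟩⟩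
    · exact IsPGroup.isMulCommutative_of_card_eq_prime_sq (p := 2) (hG := hc)
  intro a ha b hb
  exact congrArg Subtype.val (hcomm.is_comm.comm (⟨a, ha⟩ : K) ⟨b, hb⟩)

theorem mulAut_sixty {N : Type*} [Group N] [Finite N] (hcard : Nat.card N = 60)
    (hA5 : ¬ Nonempty (N ≃* alternatingGroup (Fin 5))) : Group.IsSolvable (MulAut N) := by
  have : Fact (Nat.Prime 5) := ⟨by norm_num⟩
  have h5 : Nat.card N = 5 ^ 1 * 12 := by simpa using hcard
  obtain ⟨d5, m5⟩ := sylow_num h5 (by norm_num)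
  obtain ⟨P⟩ : Nonempty (Sylow 5 N) := inferInstance
  have c5 : Nat.card (P : Subgroup N) = 5 := by simpa using sylow_card h5 (by norm_num) P
  have hn : Nat.card (Sylow 5 N) = 1 := by
    by_contra hn
    have hle := Nat.le_of_dvd (by norm_num) d5
    have h6 : Nat.card (Sylow 5 N) = 6 := by
      have h11 : Nat.card (Sylow 5 N) ≠ 11 := by
        intro h11
        rw [h11] at d5
        omega
      omega
    have hS : Six N := ⟨hcard, h6⟩
    obtain ⟨H, hH⟩ := hS.exists_index
    exact hA5 (hS.iso H hH)
  have := sylow_char hn P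
  have hq : Nat.card (N ⧸ (P : Subgroup N)) = 12 := by
    have := Subgroup.card_eq_card_quotient_mul_card_subgroup (P : Subgroup N)
    rw [hcard, c5] at this
    omega
  refine mulAut_char (P : Subgroup N) ?_ (mulAut_prime c5) (mulAut_twelve hq)
  have := isCyclic_of_prime_card c5
  intro a ha b hb
  exact congrArg Subtype.val
    ((IsCyclic.commGroup (α := (P : Subgroup N))).mul_comm (⟨a, ha⟩ : (P : Subgroup N)) ⟨b, hb⟩)

end Sixty

/-- Every finite group of order 60 not isomorphic to `A₅` has a solvable holomorph;
equivalently, it is solvable with solvable automorphism group. -/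
theorem solvable_holomorph_of_card_sixty_not_A5
    (N : Type*) [Group N] [Finite N] (hcard : Nat.card N = 60)
    (hA5 : ¬ Nonempty (N ≃* alternatingGroup (Fin 5))) :
    IsSolvable (holomorph N) ∧ IsSolvable N ∧ IsSolvable (MulAut N) := by
  have h := Sixty.mulAut_sixty hcard hA5
  exact ⟨Sixty.solvable_hol h, Sixty.solvable_of_mulAut h, h⟩
end

section
/- For every finite group N whose order belongs to {30, 36, 60, 72, 90, 120, 180}, the holomorph Hol(N) has no subgroup isomorphic to the alternating group A_6; equivalently, there is no injective group homomorphism from A_6 into Hol(N). -/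
open scoped Pointwise

namespace HolA6

universe u

/-- In a simple group of order 360, a homomorphism to a smaller group is trivial. -/
theorem hom_trivial {A H : Type*} [Group A] [Finite A] [IsSimpleGroup A] [Group H] [Finite H]
    (hc : Nat.card H < Nat.card A) (f : A →* H) (a : A) : f a = 1 := by
  rcases (inferInstance : f.ker.Normal).eq_bot_or_eq_top with h | h
  · exact absurd (Nat.card_le_card_of_injective f ((MonoidHom.ker_eq_bot_iff f).1 h)) (by omega)
  · exact MonoidHom.mem_ker.1 (h ▸ Subgroup.mem_top a)

/-- Trivial action on a subgroup and modulo it forces trivial action. -/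
theorem stab_trivial {A N : Type*} [Group A] [Finite A] [IsSimpleGroup A] [Group N] [Finite N]
    [MulDistribMulAction A N] (hc : Nat.card N < Nat.card A) (M : Subgroup N)
    (h1 : ∀ (a : A), ∀ m ∈ M, a • m = m) (h2 : ∀ (a : A) (x : N), x⁻¹ * a • x ∈ M)
    (a : A) (x : N) : a • x = x := by
  let f : A →* N := MonoidHom.mk' (fun a => x⁻¹ * a • x) (by
    intro a b
    have h := h1 a _ (h2 b x)
    rw [smul_mul', smul_inv'] at h
    rw [← h, mul_smul]
    group)
  have := hom_trivial hc f a
  have h3 : x⁻¹ * a • x = 1 := this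
  exact (inv_mul_eq_one.1 h3).symm

/-- Invariance of a characteristic subgroup. -/
theorem smul_mem_char {A N : Type*} [Group A] [Group N] [MulDistribMulAction A N]
    (M : Subgroup N) [hM : M.Characteristic] (a : A) {m : N} (hm : m ∈ M) : a • m ∈ M :=
  Subgroup.characteristic_iff_le_comap.1 hM (MulDistribMulAction.toMulEquiv N a) hm

/-- The restricted action. -/
@[reducible] def subAction (A : Type*) {N : Type*} [Group A] [Group N] [MulDistribMulAction A N]
    (M : Subgroup N) [hM : M.Characteristic] : MulDistribMulAction A M where
  smul a m := ⟨a • (m : N), smul_mem_char M a m.2⟩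
  one_smul m := Subtype.ext (one_smul A (m : N))
  mul_smul a b m := Subtype.ext (mul_smul a b (m : N))
  smul_mul a m n := Subtype.ext (smul_mul' a (m : N) (n : N))
  smul_one a := Subtype.ext (smul_one a)

/-- The quotient action. -/
@[reducible] def quotAction (A : Type*) {N : Type*} [Group A] [Group N] [MulDistribMulAction A N]
    (M : Subgroup N) [hM : M.Characteristic] : MulDistribMulAction A (N ⧸ M) where
  smul a := QuotientGroup.map M M (MulDistribMulAction.toMonoidHom N a)
    (fun _ hm => smul_mem_char M a hm)
  one_smul q := by
    induction q using QuotientGroup.induction_on with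
    | H x => exact congrArg QuotientGroup.mk (one_smul A x)
  mul_smul a b q := by
    induction q using QuotientGroup.induction_on with
    | H x => exact congrArg QuotientGroup.mk (mul_smul a b x)
  smul_mul a m n := map_mul _ m n
  smul_one a := map_one (QuotientGroup.map M M (MulDistribMulAction.toMonoidHom N a)
    (fun _ hm => smul_mem_char M a hm))

/-- The set of orders handled by the induction. -/
def Good (n : ℕ) : Prop := n ∣ 72 ∨ n ∣ 120 ∨ n ∣ 180

theorem Good.dvd {m n : ℕ} (hn : Good n) (h : m ∣ n) : Good m := by
  rcases hn with h' | h' | h'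
  · exact Or.inl (h.trans h')
  · exact Or.inr (Or.inl (h.trans h'))
  · exact Or.inr (Or.inr (h.trans h'))

theorem Good.lt {n : ℕ} (hn : Good n) : n < 360 := by
  rcases hn with h' | h' | h' <;> have := Nat.le_of_dvd (by norm_num) h' <;> omega

theorem smul_smul_sylow {A N : Type*} [Group A] [Group N] [MulDistribMulAction A N] {p : ℕ}
    (a : A) (x : N) (P : Sylow p N) : a • (x • P) = (a • x) • (a • P) := by
  ext y
  show y ∈ ((a • (x • P) : Sylow p N) : Subgroup N) ↔ y ∈ (((a • x) • (a • P) : Sylow p N) : Subgroup N)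
  rw [Sylow.pointwise_smul_def, Sylow.coe_subgroup_smul, Sylow.coe_subgroup_smul,
    Sylow.pointwise_smul_def]
  simp only [Subgroup.mem_pointwise_smul_iff_inv_smul_mem]
  simp [MulAut.smul_def, ← map_inv, MulAut.conj_apply, smul_mul']

/-- The kernel of the conjugation action on Sylow subgroups is characteristic. -/
theorem char_ker {N : Type*} [Group N] (p : ℕ) :
    (MulAction.toPermHom N (Sylow p N)).ker.Characteristic := by
  rw [Subgroup.characteristic_iff_le_comap]
  intro φ x hx
  rw [Subgroup.mem_comap]
  rw [MonoidHom.mem_ker] at hx ⊢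
  ext1 P
  have h := smul_smul_sylow (A := MulAut N) φ x (φ⁻¹ • P)
  have hx' : x • (φ⁻¹ • P) = φ⁻¹ • P := DFunLike.congr_fun hx (φ⁻¹ • P)
  rw [hx', smul_inv_smul] at h
  exact h.symm

/-- If the kernel of the Sylow action is trivial and `A` acts trivially on Sylow subgroups,
then `A` acts trivially. -/
theorem trivial_of_sylow {A N : Type*} [Group A] [Group N] [MulDistribMulAction A N] {p : ℕ}
    (hk : (MulAction.toPermHom N (Sylow p N)).ker = ⊥)
    (h : ∀ (a : A) (P : Sylow p N), a • P = P) (a : A) (x : N) : a • x = x := by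
  apply (MonoidHom.ker_eq_bot_iff _).1 hk
  ext1 P
  have := smul_smul_sylow a x P
  rw [h, h] at this
  exact this.symm

/-- Prime powers: an element of order five has to act trivially. -/
theorem trivial_of_five {A N : Type*} [Group A] [Finite A] [IsSimpleGroup A] [Group N] [Finite N]
    [MulDistribMulAction A N] (hA : Nat.card A = 360)
    (hN : ∀ m, m ∣ Nat.card N → Nat.card N ≡ m [MOD 5] → m = Nat.card N)
    (a : A) (x : N) : a • x = x := by
  have : Fact (Nat.Prime 5) := ⟨by norm_num⟩
  obtain ⟨s, hs⟩ := exists_prime_orderOf_dvd_card' (G := A) 5 (by rw [hA]; norm_num)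
  have hp : IsPGroup 5 (Subgroup.zpowers s) := IsPGroup.of_card (n := 1) (by
    rw [Nat.card_zpowers, hs, pow_one])
  have hmod := hp.card_modEq_card_fixedPoints N
  let F : Subgroup N :=
    { carrier := MulAction.fixedPoints (Subgroup.zpowers s) N
      one_mem' := fun g => smul_one (g : A)
      mul_mem' := fun {x y} hx hy g => by rw [smul_mul', hx g, hy g]
      inv_mem' := fun {x} hx g => by
        change (g : A) • x⁻¹ = x⁻¹
        rw [smul_inv']
        exact congrArg _ (hx g) }
  have hF : F = ⊤ := Subgroup.eq_top_of_card_eq F (hN _ (Subgroup.card_subgroup_dvd_card F) hmod)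
  let f := MulDistribMulAction.toMulAut A N
  have hsf : f s = 1 := by
    ext1 y
    have hy : y ∈ F := hF ▸ Subgroup.mem_top y
    exact hy ⟨s, Subgroup.mem_zpowers s⟩
  have hk : f.ker = ⊤ := by
    rcases (inferInstance : f.ker.Normal).eq_bot_or_eq_top with h | h
    · exfalso
      have h1 := (MonoidHom.ker_eq_bot_iff f).1 h (hsf.trans (map_one f).symm)
      rw [h1, orderOf_one] at hs
      omega
    · exact h
  have ha : f a = 1 := MonoidHom.mem_ker.1 (hk ▸ Subgroup.mem_top a)
  exact DFunLike.congr_fun ha x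

theorem trivial_six {A N : Type*} [Group A] [Finite A] [IsSimpleGroup A] [Group N] [Finite N]
    [MulDistribMulAction A N] (hA : Nat.card A = 360) (h3 : 2 < Nat.card N)
    (hN : Nat.card N < 360) {p : ℕ} (hp : Nat.card (Sylow p N) = 6)
    (hk : (MulAction.toPermHom N (Sylow p N)).ker = ⊥)
    (a : A) (x : N) : a • x = x := by
  let ρ := MulAction.toPermHom A (Sylow p N)
  let τ := MulAction.toPermHom N (Sylow p N)
  have : Finite (Sylow p N) := Nat.finite_of_card_ne_zero (by omega)
  have hτ : Function.Injective τ := (MonoidHom.ker_eq_bot_iff _).1 hk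
  have hcard : Nat.card (Equiv.Perm (Sylow p N)) = 720 := by
    rw [Nat.card_perm, hp]; rfl
  rcases (inferInstance : ρ.ker.Normal).eq_bot_or_eq_top with h | h
  · exfalso
    have hρ : Function.Injective ρ := (MonoidHom.ker_eq_bot_iff _).1 h
    have hconj : ∀ (a : A) (x : N), ρ a * τ x * (ρ a)⁻¹ = τ (a • x) := by
      intro a x
      rw [mul_inv_eq_iff_eq_mul]
      ext1 P
      exact smul_smul_sylow a x P
    have hK : (τ.range.comap ρ).Normal := by
      refine ⟨?_⟩
      rintro n ⟨y, hy⟩ g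
      refine ⟨g • y, ?_⟩
      rw [← hconj, hy, map_mul, map_mul, map_inv]
    rcases hK.eq_bot_or_eq_top with h' | h'
    · have hinj : Function.Injective (fun q : A × N => ρ q.1 * τ q.2) := by
        rintro ⟨a, x⟩ ⟨b, y⟩ hab
        have hab' : ρ a * τ x = ρ b * τ y := hab
        have h4 : ρ (b⁻¹ * a) = τ (y * x⁻¹) := by
          rw [map_mul, map_mul, map_inv, map_inv, eq_mul_inv_iff_mul_eq, mul_assoc, hab',
            inv_mul_cancel_left]
        have h5 : b⁻¹ * a ∈ τ.range.comap ρ := ⟨y * x⁻¹, h4.symm⟩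
        rw [h', Subgroup.mem_bot, inv_mul_eq_one] at h5
        subst h5
        have := hτ (mul_left_cancel hab')
        rw [this]
      have := Nat.card_le_card_of_injective _ hinj
      rw [Nat.card_prod, hA, hcard] at this
      omega
    · have hle : ρ.range ≤ τ.range := by
        rintro _ ⟨a, rfl⟩
        exact Subgroup.mem_comap.1 (h' ▸ Subgroup.mem_top a)
      have h6 := Subgroup.card_le_of_le hle
      rw [← Nat.card_congr (MonoidHom.ofInjective hρ).toEquiv,
        ← Nat.card_congr (MonoidHom.ofInjective hτ).toEquiv] at h6
      omega
  · refine trivial_of_sylow hk (fun a P => ?_) a x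
    have ha : ρ a = 1 := MonoidHom.mem_ker.1 (h ▸ Subgroup.mem_top a)
    exact DFunLike.congr_fun ha P

/-- Characteristically simple groups. -/
theorem trivial_charSimple {A N : Type*} [Group A] [Finite A] [IsSimpleGroup A] [Group N]
    [Finite N] [MulDistribMulAction A N] (hA : Nat.card A = 360) (hg : Good (Nat.card N))
    (hs : ∀ M : Subgroup N, M.Characteristic → M = ⊥ ∨ M = ⊤)
    (a : A) (x : N) : a • x = x := by
  -- a single Sylow subgroup
  have one : ∀ p : ℕ, p.Prime → p ∣ Nat.card N → Nat.card (Sylow p N) = 1 →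
      ∃ k, Nat.card N = p ^ k := by
    intro p hp hd h1
    have : Fact p.Prime := ⟨hp⟩
    have : Subsingleton (Sylow p N) := (Nat.card_eq_one_iff_unique.1 h1).1
    let P : Sylow p N := default
    rcases hs P inferInstance with h | h
    · exact absurd h (P.ne_bot_of_dvd_card hd)
    · have := P.isPGroup'
      obtain ⟨k, hk⟩ := IsPGroup.iff_card.1 this
      refine ⟨k, ?_⟩
      rw [← hk, h, Subgroup.card_top]
  -- several Sylow subgroups
  have many : ∀ p : ℕ, p.Prime → Nat.card (Sylow p N) ≠ 1 →
      (MulAction.toPermHom N (Sylow p N)).ker = ⊥ := by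
    intro p hp h1
    have : Fact p.Prime := ⟨hp⟩
    rcases hs _ (char_ker p) with h | h
    · exact h
    · exfalso
      apply h1
      rw [Nat.card_eq_one_iff_unique]
      refine ⟨⟨fun P Q => ?_⟩, inferInstance⟩
      obtain ⟨g, hgPQ⟩ := MulAction.exists_smul_eq N P Q
      have hgk : MulAction.toPermHom N (Sylow p N) g = 1 :=
        MonoidHom.mem_ker.1 (h ▸ Subgroup.mem_top g)
      rw [← hgPQ]
      exact (DFunLike.congr_fun hgk P).symm
  have hlt := hg.lt
  have hpos : 0 < Nat.card N := Nat.card_pos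
  -- five-argument for specific orders
  have five : Nat.card N ∈ ({1, 2, 3, 4, 5, 8, 9} : Finset ℕ) → a • x = x := by
    intro hmem
    refine trivial_of_five hA (fun m hm1 hm2 => ?_) a x
    have hle := Nat.le_of_dvd hpos hm1
    generalize Nat.card N = n at *
    have key : ∀ n ∈ ({1, 2, 3, 4, 5, 8, 9} : Finset ℕ), ∀ m ≤ n, m ∣ n → n % 5 = m % 5 → m = n := by
      decide
    exact key n hmem m hle hm1 hm2
  have syl : ∀ p : ℕ, p.Prime → Nat.card (Sylow p N) ∣ Nat.card N ∧ Nat.card (Sylow p N) % p = 1 := by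
    intro p hp
    have : Fact p.Prime := ⟨hp⟩
    let P : Sylow p N := default
    refine ⟨P.card_dvd_index.trans (Subgroup.index_dvd_card _), ?_⟩
    have := card_sylow_modEq_one p N
    rw [Nat.ModEq, Nat.mod_eq_of_lt hp.one_lt] at this
    exact this
  by_cases h5 : 5 ∣ Nat.card N
  · have hp5 : Nat.Prime 5 := by norm_num
    have : Fact (Nat.Prime 5) := ⟨hp5⟩
    obtain ⟨hd, hm⟩ := syl 5 hp5
    have hcases : Nat.card (Sylow 5 N) = 1 ∨ Nat.card (Sylow 5 N) = 6 ∨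
        (Nat.card (Sylow 5 N) = 36 ∧ Nat.card N = 180) := by
      have hle := Nat.le_of_dvd hpos hd
      generalize Nat.card (Sylow 5 N) = s at *
      generalize Nat.card N = n at *
      have key : ∀ d ∈ ({72, 120, 180} : Finset ℕ), ∀ n ∈ d.divisors, 5 ∣ n → ∀ s ∈ n.divisors,
        s % 5 = 1 → s = 1 ∨ s = 6 ∨ (s = 36 ∧ n = 180) := by decide +kernel
      have hn0 : n ≠ 0 := by omega
      rcases hg with h | h | h
      · exact key 72 (by decide) n (by simp [h]) h5 s (by simp [hd, hn0]) hm
      · exact key 120 (by decide) n (by simp [h]) h5 s (by simp [hd, hn0]) hm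
      · exact key 180 (by decide) n (by simp [h]) h5 s (by simp [hd, hn0]) hm
    rcases hcases with h | h | ⟨h, hn⟩
    · obtain ⟨k, hk⟩ := one 5 hp5 h5 h
      apply five
      rw [hk] at hg hlt ⊢
      have hk3 : k < 4 := by
        by_contra hcon
        have := Nat.pow_le_pow_right (show 0 < 5 by norm_num) (not_lt.1 hcon)
        omega
      interval_cases k <;> revert hg <;> unfold Good <;> decide
    · exact trivial_six hA (by have := Nat.le_of_dvd hpos h5; omega) hlt h
        (many 5 hp5 (by omega)) a x
    · exfalso
      let P : Sylow 5 N := default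
      have hidx := P.card_eq_index_normalizer
      have hmul := Subgroup.card_mul_index (Subgroup.normalizer (P : Set N))
      rw [← hidx, h, hn] at hmul
      have hNcard : Nat.card (Subgroup.normalizer (P : Set N)) = 5 := by omega
      have h5P : 5 ∣ Nat.card P := P.dvd_card_of_dvd_card h5
      have hPle : (P : Subgroup N) ≤ Subgroup.normalizer (P : Set N) := Subgroup.le_normalizer
      have hPN : (P : Subgroup N) = Subgroup.normalizer (P : Set N) := by
        apply Subgroup.eq_of_le_of_card_ge hPle
        rw [hNcard]
        exact Nat.le_of_dvd Nat.card_pos h5P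
      have hcyc : IsCyclic P := isCyclic_of_prime_card (p := 5)
        ((congrArg (fun H : Subgroup N => Nat.card H) hPN).trans hNcard)
      have hcent : Subgroup.normalizer (P : Set N) ≤ Subgroup.centralizer (P : Set N) := by
        rw [← hPN]
        intro y hy z hz
        let := hcyc.commGroup
        exact congrArg Subtype.val (mul_comm (⟨z, hz⟩ : P) ⟨y, hy⟩)
      have hnd := MonoidHom.not_dvd_card_ker_transferSylow P hcent
      have hcomm : commutator N ≤ (MonoidHom.transferSylow P hcent).ker := by
        let := hcyc.commGroup
        exact Abelianization.commutator_subset_ker (MonoidHom.transferSylow P hcent)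
      rcases hs (commutator N) inferInstance with hc | hc
      · have : (P : Subgroup N).Normal := by
          refine ⟨fun n hn g => ?_⟩
          have : g * n * g⁻¹ * n⁻¹ ∈ commutator N :=
            Subgroup.commutator_mem_commutator (Subgroup.mem_top g) (Subgroup.mem_top n)
          rw [hc, Subgroup.mem_bot, mul_inv_eq_one] at this
          rwa [this]
        have hu := Sylow.unique_of_normal P this
        rw [Nat.card_unique] at h
        omega
      · rw [hc, top_le_iff] at hcomm
        rw [hcomm, Subgroup.card_top] at hnd
        exact hnd h5
  · have h72 : Nat.card N ∣ 72 := by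
      have hc : Nat.Coprime (Nat.card N) 5 :=
        ((Nat.Prime.coprime_iff_not_dvd (by norm_num)).2 h5).symm
      rcases hg with h | h | h
      · exact h
      · exact (hc.dvd_of_dvd_mul_right (show Nat.card N ∣ 24 * 5 from h)).trans (by norm_num)
      · exact (hc.dvd_of_dvd_mul_right (show Nat.card N ∣ 36 * 5 from h)).trans (by norm_num)
    by_cases h3 : 3 ∣ Nat.card N
    · have hp3 : Nat.Prime 3 := by norm_num
      obtain ⟨hd, hm⟩ := syl 3 hp3
      have hcases : Nat.card (Sylow 3 N) = 1 ∨ Nat.card (Sylow 3 N) = 4 := by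
        have hd' := hd.trans h72
        generalize Nat.card (Sylow 3 N) = s at *
        have key : ∀ s ∈ (72 : ℕ).divisors, s % 3 = 1 → s = 1 ∨ s = 4 := by decide +kernel
        exact key s (by simp [hd']) hm
      rcases hcases with h | h
      · obtain ⟨k, hk⟩ := one 3 hp3 h3 h
        apply five
        rw [hk] at h72 ⊢
        have hk3 : k < 4 := by
          by_contra hcon
          have := Nat.pow_le_pow_right (show 0 < 3 by norm_num) (not_lt.1 hcon)
          have := Nat.le_of_dvd (by norm_num) h72
          omega
        interval_cases k <;> revert h72 <;> decide
      · have : Finite (Sylow 3 N) := Nat.finite_of_card_ne_zero (by omega)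
        refine trivial_of_sylow (many 3 hp3 (by omega)) (fun a P => ?_) a x
        have hcard : Nat.card (Equiv.Perm (Sylow 3 N)) < Nat.card A := by
          rw [Nat.card_perm, h, hA]; decide
        exact DFunLike.congr_fun (hom_trivial hcard (MulAction.toPermHom A (Sylow 3 N)) a) P
    · have h8 : Nat.card N ∣ 8 := by
        have hc : Nat.Coprime (Nat.card N) (3 ^ 2) :=
          (((Nat.Prime.coprime_iff_not_dvd (by norm_num)).2 h3).symm).pow_right 2
        exact hc.dvd_of_dvd_mul_right (show Nat.card N ∣ 8 * 3 ^ 2 from h72)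
      apply five
      have hle := Nat.le_of_dvd (by norm_num) h8
      generalize Nat.card N = n at *
      interval_cases n <;> revert h8 <;> decide

theorem trivial_action {A : Type*} [Group A] [Finite A] [IsSimpleGroup A]
    (hA : Nat.card A = 360) (n : ℕ) : ∀ (N : Type u) [Group N] [Finite N]
    [MulDistribMulAction A N], Nat.card N = n → Good n → ∀ (a : A) (x : N), a • x = x := by
  induction n using Nat.strong_induction_on with
  | _ n ih =>
    intro N _ _ _ hn hg a x
    subst hn
    by_cases hs : ∀ M : Subgroup N, M.Characteristic → M = ⊥ ∨ M = ⊤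
    · exact trivial_charSimple hA hg hs a x
    · push Not at hs
      obtain ⟨M, hM, hb, ht⟩ := hs
      have hmul := Subgroup.card_mul_index M
      have hM1 : 1 < Nat.card M := Subgroup.one_lt_card_iff_ne_bot M |>.2 hb
      have hi1 : M.index ≠ 1 := fun h => ht (Subgroup.index_eq_one.1 h)
      have hi0 : M.index ≠ 0 := Subgroup.index_ne_zero_of_finite
      have hMlt : Nat.card M < Nat.card N := by
        rw [← hmul]; exact lt_mul_of_one_lt_right (by omega) (by omega)
      have hQlt : Nat.card (N ⧸ M) < Nat.card N := by
        change M.index < _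
        rw [← hmul]; exact lt_mul_of_one_lt_left (by omega) (by omega)
      have hMd : Nat.card M ∣ Nat.card N := Subgroup.card_subgroup_dvd_card M
      have hQd : Nat.card (N ⧸ M) ∣ Nat.card N := Subgroup.index_dvd_card M
      refine stab_trivial (by rw [hA]; exact hg.lt) M ?_ ?_ a x
      · intro a m hm
        let := subAction A M
        exact congrArg Subtype.val (ih _ hMlt M rfl (hg.dvd hMd) a ⟨m, hm⟩)
      · intro a x
        let := quotAction A M
        have := ih _ hQlt (N ⧸ M) rfl (hg.dvd hQd) a (x : N ⧸ M)
        exact QuotientGroup.eq.1 this.symm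

theorem card_A6 : Nat.card (alternatingGroup (Fin 6)) = 360 := by
  have := two_mul_nat_card_alternatingGroup (α := Fin 6)
  rw [Nat.card_perm, Nat.card_fin] at this
  have h : Nat.factorial 6 = 720 := rfl
  omega

end HolA6

/-- For every finite group `N` of order 30, 36, 60, 72, 90, 120 or 180, the holomorph of
`N` has no subgroup isomorphic to `A₆`: there is no injective homomorphism from `A₆`
into `Hol(N)`. -/
theorem holomorph_no_A6
    (N : Type*) [Group N] [Finite N]
    (hcard : Nat.card N ∈ ({30, 36, 60, 72, 90, 120, 180} : Set ℕ)) :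
    ¬ ∃ f : alternatingGroup (Fin 6) →* holomorph N, Function.Injective f := by
  rintro ⟨f, hf⟩
  have : IsSimpleGroup (alternatingGroup (Fin 6)) := alternatingGroup.isSimpleGroup (by simp)
  have hA := HolA6.card_A6
  have hg : HolA6.Good (Nat.card N) := by
    simp only [Set.mem_insert_iff, Set.mem_singleton_iff] at hcard
    unfold HolA6.Good
    rcases hcard with h | h | h | h | h | h | h <;> rw [h] <;> decide
  let R : Subgroup (Equiv.Perm N) := (MulAction.toPermHom N N).range
  have hRcard : Nat.card R = Nat.card N :=
    (Nat.card_congr (MonoidHom.ofInjective (f := MulAction.toPermHom N N)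
      MulAction.toPerm_injective).toEquiv).symm
  let ψ : alternatingGroup (Fin 6) →* MulAut R := (Subgroup.normalizerMonoidHom R).comp f
  let : MulDistribMulAction (alternatingGroup (Fin 6)) R := MulDistribMulAction.compHom R ψ
  have key : ∀ (a : alternatingGroup (Fin 6)) (r : R), ψ a r = r :=
    HolA6.trivial_action hA _ R hRcard hg
  have hcomm : ∀ (a : alternatingGroup (Fin 6)) (x y : N),
      (f a : Equiv.Perm N) (x * y) = x * (f a : Equiv.Perm N) y := by
    intro a x y
    have h1 : (f a : Equiv.Perm N) * MulAction.toPermHom N N x * (f a : Equiv.Perm N)⁻¹ =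
        MulAction.toPermHom N N x := congrArg Subtype.val (key a ⟨_, x, rfl⟩)
    rw [mul_inv_eq_iff_eq_mul] at h1
    exact DFunLike.congr_fun h1 y
  let g : alternatingGroup (Fin 6) →* N := MonoidHom.mk' (fun a => ((f a : Equiv.Perm N) 1)⁻¹) (by
    intro a b
    have h2 : (f (a * b) : Equiv.Perm N) 1 =
        (f b : Equiv.Perm N) 1 * (f a : Equiv.Perm N) 1 := by
      rw [← hcomm a, mul_one, map_mul]
      rfl
    rw [h2, mul_inv_rev])
  have hg1 : ∀ a, (f a : Equiv.Perm N) 1 = 1 := fun a =>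
    inv_eq_one.1 (HolA6.hom_trivial (by rw [hA]; exact hg.lt) g a)
  have hf1 : ∀ a, f a = 1 := by
    intro a
    apply Subtype.ext
    ext x
    have := hcomm a x 1
    rw [hg1, mul_one] at this
    exact this
  obtain ⟨a, b, hab⟩ := exists_pair_ne (alternatingGroup (Fin 6))
  exact hab (hf ((hf1 a).trans (hf1 b).symm))
end
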